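/- arXiv:1408.2667 — 4 statements merged into one kernel-verified Lean document; each statement's English description precedes it below -/
import Mathlib

section
/- Let A and B be C*-algebras, π : A → B a surjective *-homomorphism, and ε > 0. For every y ∈ B with ‖y*y − yy*‖ ≤ ε‖y‖, there exists x ∈ A with π(x) = y, ‖x‖ = ‖y‖, and ‖x*x − xx*‖ ≤ 2ε‖x‖. -/
lemma aux_lift {A B : Type*} [CStarAlgebra A] [CStarAlgebra B]
    (π : A →⋆ₐ[ℂ] B) (c : A) : ∃ c' : A, π c' = π c ∧ ‖c'‖ ≤ ‖π c‖ := by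
  rcases eq_or_ne (π c) 0 with h0 | h0
  · exact ⟨0, by simp [h0], by simp⟩
  have hr : 0 < ‖π c‖ := norm_pos_iff.mpr h0
  set r := ‖π c‖ with hrdef
  let f : ℝ → ℝ := fun t => r / max r (Real.sqrt t)
  have hpos : ∀ t, 0 < max r (Real.sqrt t) := fun t => lt_max_of_lt_left hr
  have hf : Continuous f := by
    refine continuous_const.div (by fun_prop) fun t => (hpos t).ne'
  have hπ : Continuous π := AddMonoidHomClass.continuous_of_bound π 1
      (by simpa only [one_mul] using NonUnitalStarAlgHom.norm_apply_le π)
  have hsa : IsSelfAdjoint (star c * c) := IsSelfAdjoint.star_mul_self c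
  have hsaB : IsSelfAdjoint (star (π c) * π c) := IsSelfAdjoint.star_mul_self _
  refine ⟨c * cfc f (star c * c), ?_, ?_⟩
  · have h1 : π (cfc f (star c * c)) = cfc f (star (π c) * π c) := by
      have := StarAlgHomClass.map_cfc π f (star c * c) hf.continuousOn hπ hsa
        (by simpa [map_mul, map_star] using hsaB)
      simpa [map_mul, map_star] using this
    have h2 : cfc f (star (π c) * π c) = 1 := by
      rw [← cfc_one ℝ (star (π c) * π c) hsaB]
      refine cfc_congr fun t ht => ?_
      have h3 := IsometricContinuousFunctionalCalculus.norm_spectrum_le (𝕜 := ℝ) _ ht hsaB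
      rw [CStarRing.norm_star_mul_self, ← hrdef] at h3
      have h4 : Real.sqrt t ≤ r := by
        rw [Real.sqrt_le_left hr.le]
        calc t ≤ ‖t‖ := Real.le_norm_self t
          _ ≤ r ^ 2 := by rw [sq]; exact h3
      simp [f, max_eq_left h4, hr.ne']
    rw [map_mul, h1, h2, mul_one]
  · have hg : IsSelfAdjoint (cfc f (star c * c)) := cfc_predicate f _
    have h1 : star (c * cfc f (star c * c)) * (c * cfc f (star c * c))
        = cfc (fun t => f t * t * f t) (star c * c) := by
      rw [cfc_mul (fun t => f t * t) f _ (by fun_prop) (by fun_prop),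
        cfc_mul f (fun t => t) _ (by fun_prop) (by fun_prop), cfc_id' ℝ _ hsa,
        star_mul, hg.star_eq]
      simp only [mul_assoc]
    have h2 : ‖cfc (fun t => f t * t * f t) (star c * c)‖ ≤ r ^ 2 := by
      refine norm_cfc_le (by positivity) fun t ht => ?_
      have ht0 : 0 ≤ t := spectrum_star_mul_self_nonneg t ht
      have hm := hpos t
      have : t ≤ max r (Real.sqrt t) ^ 2 := by
        calc t = Real.sqrt t ^ 2 := (Real.sq_sqrt ht0).symm
          _ ≤ _ := by gcongr; exact le_max_right _ _
      have hft : f t * t * f t = r ^ 2 * (t / max r (Real.sqrt t) ^ 2) := by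
        simp only [f]; field_simp
      rw [hft, Real.norm_of_nonneg (by positivity)]
      have : t / max r (Real.sqrt t) ^ 2 ≤ 1 := div_le_one_of_le₀ this (by positivity)
      nlinarith [sq_nonneg r]
    rw [← h1, CStarRing.norm_star_mul_self, ← sq] at h2
    exact (sq_le_sq₀ (norm_nonneg _) hr.le).mp h2

lemma aux_unit {A B : Type*} [CStarAlgebra A] [CStarAlgebra B]
    (π : A →⋆ₐ[ℂ] B) (a₁ a₂ k : A) (h₁ : π a₁ = 0) (h₂ : π a₂ = 0) (hk : π k = 0)
    (δ : ℝ) (hδ : 0 < δ) :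
    ∃ w : A, IsSelfAdjoint w ∧ π w = 1 ∧ ‖w‖ ≤ 1 ∧ ‖a₁ * w‖ ≤ δ ∧ ‖a₂ * w‖ ≤ δ ∧ ‖w * k‖ ≤ δ := by
  letI := CStarAlgebra.spectralOrder A
  haveI := CStarAlgebra.spectralOrderedRing A
  set b : A := star a₁ * a₁ + star a₂ * a₂ + k * star k with hb
  have n1 := star_mul_self_nonneg a₁
  have n2 := star_mul_self_nonneg a₂
  have n3 := mul_star_self_nonneg k
  have hb0 : 0 ≤ b := by positivity
  have hbs : IsSelfAdjoint b := .of_nonneg hb0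
  let η := δ ^ 2
  have hη : 0 < η := by positivity
  let f : ℝ → ℝ := fun t => η / (η + |t|)
  have hp : ∀ t : ℝ, 0 < η + |t| := fun t => by positivity
  have hf : Continuous f := continuous_const.div (by fun_prop) fun t => (hp t).ne'
  have hw : IsSelfAdjoint (cfc f b) := cfc_predicate f _
  have hwbw : ‖cfc f b * b * cfc f b‖ ≤ δ ^ 2 := by
    have h1 : cfc f b * b * cfc f b = cfc (fun t => f t * t * f t) b := by
      rw [cfc_mul (fun t => f t * t) f _ (by fun_prop) (by fun_prop),
        cfc_mul f (fun t => t) _ (by fun_prop) (by fun_prop), cfc_id' ℝ _ hbs]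
    rw [h1]
    refine norm_cfc_le (by positivity) fun t ht => ?_
    have := hp t
    rw [norm_mul, norm_mul, Real.norm_of_nonneg (show 0 ≤ f t by positivity), Real.norm_eq_abs]
    have h2 : f t * |t| ≤ η := by
      simp only [f]
      rw [div_mul_eq_mul_div, div_le_iff₀ this]
      nlinarith
    have h3 : f t ≤ 1 := by
      simp only [f]
      rw [div_le_one this]; linarith [abs_nonneg t]
    have h4 : 0 ≤ f t := by positivity
    have h5 := abs_nonneg t
    calc f t * |t| * f t ≤ η * 1 := by gcongr
      _ = δ ^ 2 := mul_one _
  have key : ∀ z : A, star z * z ≤ b → ‖z * cfc f b‖ ≤ δ := by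
    intro z hz
    have h1 : star (cfc f b) * (star z * z) * cfc f b ≤ star (cfc f b) * b * cfc f b :=
      star_left_conjugate_le_conjugate hz _
    have h0 : 0 ≤ star (cfc f b) * (star z * z) * cfc f b :=
      star_left_conjugate_nonneg (star_mul_self_nonneg z) _
    have h2 := CStarAlgebra.norm_le_norm_of_nonneg_of_le h0 h1
    rw [hw.star_eq] at h2
    have h3 : cfc f b * (star z * z) * cfc f b = star (z * cfc f b) * (z * cfc f b) := by
      rw [star_mul, hw.star_eq]; simp only [mul_assoc]
    rw [h3, CStarRing.norm_star_mul_self, ← sq] at h2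
    exact (sq_le_sq₀ (norm_nonneg _) hδ.le).mp (h2.trans hwbw)
  refine ⟨cfc f b, hw, ?_, ?_, key _ ?_, key _ ?_, ?_⟩
  · have hπ : Continuous π := AddMonoidHomClass.continuous_of_bound π 1
      (by simpa only [one_mul] using NonUnitalStarAlgHom.norm_apply_le π)
    have hπb : π b = 0 := by simp [hb, h₁, h₂, hk]
    rw [StarAlgHomClass.map_cfc π f b hf.continuousOn hπ hbs (by rw [hπb]; exact .zero _), hπb,
      cfc_apply_zero]
    simp [f, hη.ne']
  · refine norm_cfc_le zero_le_one fun t _ => ?_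
    have := hp t
    rw [Real.norm_of_nonneg (show 0 ≤ f t by positivity)]
    simp only [f]
    rw [div_le_one this]; linarith [abs_nonneg t]
  · rw [hb, add_assoc]; exact le_add_of_nonneg_right (by positivity)
  · rw [hb, add_assoc, add_left_comm]; exact le_add_of_nonneg_right (by positivity)
  · have := key (star k) (by rw [star_star, hb]; exact le_add_of_nonneg_left (by positivity))
    rwa [← norm_star, star_mul, hw.star_eq]

lemma aux_ind {A B : Type*} [CStarAlgebra A] [CStarAlgebra B]
    (π : A →⋆ₐ[ℂ] B) (x k : A) (hk : π k = 0) (δ : ℝ) (hδ : 0 < δ) (n : ℕ) :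
    ∃ W : A, IsSelfAdjoint W ∧ π W = n ∧ ‖W‖ ≤ n ∧ ‖W * k‖ ≤ n * δ ∧
      ‖W * x - x * W‖ ^ 2 ≤ n * (4 * ‖x‖ ^ 2 + 1) := by
  induction n with
  | zero => exact ⟨0, .zero _, by simp, by simp, by simp, by simp⟩
  | succ n ih =>
    obtain ⟨W, hW, hπW, hWn, hWk, hWx⟩ := ih
    set D := W * x - x * W with hD
    have hπD : π D = 0 := by
      rw [hD, map_sub, map_mul, map_mul, hπW, (Nat.cast_commute n (π x)).eq, sub_self]
    let δ' := min δ (1 / (2 * (1 + ‖x‖)))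
    have hx0 := norm_nonneg x
    have hδ' : 0 < δ' := by positivity
    obtain ⟨w, hw, hπw, hw1, h1, h2, h3⟩ := aux_unit π (D * star x) D k (by simp [hπD]) hπD hk δ' hδ'
    set d := w * x - x * w with hd
    have hdn : ‖d‖ ≤ 2 * ‖x‖ := by
      calc ‖d‖ ≤ ‖w‖ * ‖x‖ + ‖x‖ * ‖w‖ := (norm_sub_le _ _).trans
            (add_le_add (norm_mul_le _ _) (norm_mul_le _ _))
        _ ≤ 1 * ‖x‖ + ‖x‖ * 1 := by gcongr
        _ = _ := by ring
    have hDd : ‖D * star d‖ ≤ 1 / 2 := by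
      have e : D * star d = D * star x * w - D * w * star x := by
        rw [hd, star_sub, star_mul, star_mul, hw.star_eq, mul_sub]; simp only [mul_assoc]
      calc ‖D * star d‖ ≤ ‖D * star x * w‖ + ‖D * w‖ * ‖x‖ := by
            rw [e]; refine (norm_sub_le _ _).trans ?_
            gcongr
            refine (norm_mul_le _ _).trans ?_
            rw [norm_star]
        _ ≤ δ' + δ' * ‖x‖ := by gcongr
        _ = δ' * (1 + ‖x‖) := by ring
        _ ≤ 1 / (2 * (1 + ‖x‖)) * (1 + ‖x‖) := by gcongr; exact min_le_right _ _
        _ = 1 / 2 := by field_simp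
    refine ⟨W + w, hW.add hw, by simp [hπW, hπw], ?_, ?_, ?_⟩
    · push_cast; exact (norm_add_le _ _).trans (add_le_add hWn hw1)
    · push_cast; rw [add_mul, add_mul, one_mul]
      exact (norm_add_le _ _).trans (add_le_add hWk (h3.trans (min_le_left _ _)))
    · have e : (W + w) * x - x * (W + w) = D + d := by rw [hD, hd]; noncomm_ring
      have e2 : (D + d) * star (D + d) = D * star D + D * star d + star (D * star d) + d * star d := by
        rw [star_add, star_mul, star_star]; noncomm_ring
      rw [e, sq, ← CStarRing.norm_self_mul_star, e2]
      calc _ ≤ ‖D * star D‖ + ‖D * star d‖ + ‖star (D * star d)‖ + ‖d * star d‖ := norm_add₄_le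
        _ = ‖D‖ ^ 2 + ‖D * star d‖ + ‖D * star d‖ + ‖d‖ ^ 2 := by
          rw [norm_star, CStarRing.norm_self_mul_star, CStarRing.norm_self_mul_star, sq, sq]
        _ ≤ n * (4 * ‖x‖ ^ 2 + 1) + 1 / 2 + 1 / 2 + (2 * ‖x‖) ^ 2 := by gcongr
        _ = _ := by push_cast; ring

lemma aux_quasi {A B : Type*} [CStarAlgebra A] [CStarAlgebra B]
    (π : A →⋆ₐ[ℂ] B) (x k : A) (hk : π k = 0) (δ : ℝ) (hδ : 0 < δ) :
    ∃ w : A, IsSelfAdjoint w ∧ π w = 1 ∧ ‖w‖ ≤ 1 ∧ ‖w * k‖ ≤ δ ∧ ‖w * x - x * w‖ ≤ δ := by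
  obtain ⟨n, hn⟩ := exists_nat_gt ((4 * ‖x‖ ^ 2 + 1) / δ ^ 2)
  have hn0 : (0 : ℝ) < n := lt_of_le_of_lt (by positivity) hn
  obtain ⟨W, hW, hπW, hWn, hWk, hWx⟩ := aux_ind π x k hk δ hδ n
  have hnorm : ∀ z : A, ‖((n : ℝ)⁻¹ : ℂ) • z‖ = (n : ℝ)⁻¹ * ‖z‖ := fun z => by
    rw [norm_smul]; simp
  refine ⟨((n : ℝ)⁻¹ : ℂ) • W, ?_, ?_, ?_, ?_, ?_⟩
  · rw [IsSelfAdjoint, star_smul, hW.star_eq]; simp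
  · have : (n : ℂ) ≠ 0 := by exact_mod_cast hn0.ne'
    rw [map_smul, hπW, ← map_natCast (algebraMap ℂ B), Algebra.algebraMap_eq_smul_one, smul_smul]
    simp [this]
  · rw [hnorm, inv_mul_le_iff₀ hn0]; simpa using hWn
  · rw [smul_mul_assoc, hnorm, inv_mul_le_iff₀ hn0]; exact hWk
  · rw [smul_mul_assoc, mul_smul_comm, ← smul_sub, hnorm, inv_mul_le_iff₀ hn0]
    rw [← sq_le_sq₀ (norm_nonneg _) (by positivity)]
    rw [div_lt_iff₀ (by positivity)] at hn
    calc _ ≤ _ := hWx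
      _ ≤ n * (n * δ ^ 2) := by gcongr
      _ = _ := by ring

lemma aux_main {A B : Type*} [CStarAlgebra A] [CStarAlgebra B]
    (π : A →⋆ₐ[ℂ] B) (hπ : Function.Surjective π)
    (ε : ℝ) (hε : 0 < ε) (y : B)
    (hy : ‖star y * y - y * star y‖ ≤ ε * ‖y‖) :
    ∃ x : A, π x = y ∧ ‖x‖ = ‖y‖ ∧ ‖star x * x - x * star x‖ ≤ 2 * ε * ‖x‖ := by
  rcases eq_or_ne y 0 with rfl | hy0
  · exact ⟨0, by simp⟩
  have hyp : 0 < ‖y‖ := norm_pos_iff.mpr hy0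
  obtain ⟨x₁, rfl⟩ := hπ y
  obtain ⟨x, hx, hxn⟩ := aux_lift π x₁
  rw [← hx] at hy hy0 hyp hxn ⊢
  obtain ⟨c, hc, hcn⟩ := aux_lift π (star x * x - x * star x)
  set k := star x * x - x * star x - c with hkdef
  have hk : π k = 0 := by rw [hkdef, map_sub, hc, sub_self]
  set δ := ε * ‖π x‖ / (1 + 2 * ‖x‖) with hδdef
  have hx0 := norm_nonneg x
  have hδ : 0 < δ := by positivity
  obtain ⟨w, hw, hπw, hw1, hwk, hwx⟩ := aux_quasi π x k hk δ hδ
  have hπe : π (w * x) = π x := by rw [map_mul, hπw, one_mul]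
  have hn : ‖w * x‖ = ‖π x‖ := by
    apply le_antisymm
    · calc ‖w * x‖ ≤ ‖w‖ * ‖x‖ := norm_mul_le _ _
        _ ≤ 1 * ‖π x‖ := by gcongr
        _ = _ := one_mul _
    · rw [← hπe]; exact NonUnitalStarAlgHom.norm_apply_le π _
  refine ⟨w * x, hπe, hn, ?_⟩
  rw [hn]
  set d := w * x - x * w with hd
  have hsd : star d = star x * w - w * star x := by
    rw [hd, star_sub, star_mul, star_mul, hw.star_eq]
  have e : star (w * x) * (w * x) - w * x * star (w * x)
      = star x * w * d + star d * x * w + w * k * w + w * c * w := by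
    rw [hsd, star_mul, hw.star_eq, hd, hkdef]; noncomm_ring
  have hcn' : ‖c‖ ≤ ε * ‖π x‖ := by
    refine hcn.trans ?_
    simpa only [map_sub, map_mul, map_star] using hy
  rw [e]
  calc _ ≤ ‖star x * w * d‖ + ‖star d * x * w‖ + ‖w * k * w‖ + ‖w * c * w‖ := norm_add₄_le
    _ ≤ ‖x‖ * 1 * δ + δ * ‖x‖ * 1 + δ * 1 + 1 * (ε * ‖π x‖) * 1 := by
      gcongr
      · refine (norm_mul₃_le).trans ?_
        rw [norm_star]; gcongr
      · refine (norm_mul₃_le).trans ?_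
        rw [norm_star]; gcongr
      · refine (norm_mul_le _ _).trans ?_
        gcongr
      · refine (norm_mul₃_le).trans ?_
        gcongr
    _ = δ * (1 + 2 * ‖x‖) + ε * ‖π x‖ := by ring
    _ = 2 * ε * ‖π x‖ := by rw [hδdef]; field_simp; ring



/-- Almost normal elements in quotients admit (almost as) almost normal
preimages of the same norm: if `π : A → B` is a surjective *-homomorphism of
C*-algebras and `y ∈ B` is ε-normal, then `y` has a 2ε-normal preimage `x`
with `‖x‖ = ‖y‖`. -/
theorem exists_almostNormal_preimage
    {A B : Type*}
    [NormedRing A] [StarRing A] [CStarRing A] [NormedAlgebra ℂ A]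
    [StarModule ℂ A] [CompleteSpace A]
    [NormedRing B] [StarRing B] [CStarRing B] [NormedAlgebra ℂ B]
    [StarModule ℂ B] [CompleteSpace B]
    (π : A →⋆ₐ[ℂ] B) (hπ : Function.Surjective π)
    (ε : ℝ) (hε : 0 < ε) (y : B)
    (hy : ‖star y * y - y * star y‖ ≤ ε * ‖y‖) :
    ∃ x : A, π x = y ∧ ‖x‖ = ‖y‖ ∧ ‖star x * x - x * star x‖ ≤ 2 * ε * ‖x‖ := by
  letI iA : CStarAlgebra A :=
    { ‹NormedRing A›, ‹StarRing A›, ‹CStarRing A›, ‹NormedAlgebra ℂ A›, ‹StarModule ℂ A›,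
      ‹CompleteSpace A› with }
  letI iB : CStarAlgebra B :=
    { ‹NormedRing B›, ‹StarRing B›, ‹CStarRing B›, ‹NormedAlgebra ℂ B›, ‹StarModule ℂ B›,
      ‹CompleteSpace B› with }
  exact aux_main π hπ ε hε y hy
end

section
/- Let A be a C*-algebra, x ∈ A, and λ > 0. Then the set {J ∈ Prim(A) : ‖x + J‖ ≥ λ} is compact in the Jacobson topology on Prim(A). -/
/-- A representation of a C*-algebra `A` on a Hilbert space. -/
structure HilbertRep (A : Type) [NonUnitalNormedRing A] [StarRing A]
    [NormedSpace ℂ A] [IsScalarTower ℂ A A] [SMulCommClass ℂ A A] where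
  carrier : Type
  [ng : NormedAddCommGroup carrier]
  [ip : InnerProductSpace ℂ carrier]
  [cs : CompleteSpace carrier]
  π : A →⋆ₙₐ[ℂ] (carrier →L[ℂ] carrier)

attribute [instance] HilbertRep.ng HilbertRep.ip HilbertRep.cs

variable {A : Type} [NonUnitalNormedRing A] [StarRing A] [CStarRing A]
  [NormedSpace ℂ A] [IsScalarTower ℂ A A] [SMulCommClass ℂ A A]
  [StarModule ℂ A] [CompleteSpace A]

/-- A representation is (topologically) irreducible if it is nonzero and has
no nontrivial closed invariant subspaces. -/
def HilbertRep.IsIrreducible (ρ : HilbertRep A) : Prop :=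
  ρ.π ≠ 0 ∧ ∀ V : Submodule ℂ ρ.carrier, IsClosed (V : Set ρ.carrier) →
    (∀ a : A, ∀ v ∈ V, ρ.π a v ∈ V) → V = ⊥ ∨ V = ⊤

/-- A subset of `A` is a primitive ideal if it is the kernel of an irreducible
representation on some Hilbert space. -/
def IsPrimitive (P : Set A) : Prop :=
  ∃ ρ : HilbertRep A, ρ.IsIrreducible ∧ P = {a : A | ρ.π a = 0}

/-- The primitive ideal space of `A`. -/
def PrimSpace (A : Type) [NonUnitalNormedRing A] [StarRing A] [CStarRing A]
    [NormedSpace ℂ A] [IsScalarTower ℂ A A] [SMulCommClass ℂ A A]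
    [StarModule ℂ A] [CompleteSpace A] : Type :=
  {P : Set A // IsPrimitive P}

/-- The Jacobson (hull-kernel) topology on the primitive ideal space: the open
sets are generated by the complements of hulls of subsets. -/
instance : TopologicalSpace (PrimSpace A) :=
  TopologicalSpace.generateFrom
    {U : Set (PrimSpace A) | ∃ S : Set A, U = {J : PrimSpace A | ¬ S ⊆ J.1}}

open scoped ComplexOrder InnerProductSpace

/-- A two-sided star-closed (not necessarily topologically closed) ideal. -/
structure IdealLike {U : Type} [CStarAlgebra U] (I : Submodule ℂ U) : Prop where
  mul_left : ∀ b, ∀ i ∈ I, b * i ∈ I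
  mul_right : ∀ b, ∀ i ∈ I, i * b ∈ I
  star_mem : ∀ i ∈ I, star i ∈ I

/-- States vanishing on `I`. -/
structure StateOn {U : Type} [CStarAlgebra U] (I : Submodule ℂ U) (φ : U → ℂ) : Prop where
  one : φ 1 = 1
  pos : ∀ b, 0 ≤ φ (star b * b)
  van : ∀ i ∈ I, φ i = 0

section unital

variable {U : Type} [CStarAlgebra U] [PartialOrder U] [StarOrderedRing U]

theorem approx_aux (I : Submodule ℂ U) (hI : IdealLike I) (i : U) (hi : i ∈ I)
    (hsa : IsSelfAdjoint i) (ε : ℝ) (hε : 0 < ε) :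
    ∃ y : U, IsSelfAdjoint y ∧ 1 - y ∈ I ∧ ‖y‖ ≤ 1 ∧ ‖y * i * y‖ ≤ ε := by
  have hpos : ∀ s : ℝ, 0 < ε ^ 2 + s ^ 2 := fun s => by positivity
  have hc : Continuous (fun s : ℝ => ε ^ 2 / (ε ^ 2 + s ^ 2)) :=
    continuous_const.div (by fun_prop) (fun s => (hpos s).ne')
  have hc2 : Continuous (fun s : ℝ => s / (ε ^ 2 + s ^ 2)) :=
    continuous_id.div (by fun_prop) (fun s => (hpos s).ne')
  refine ⟨cfc (fun s : ℝ => ε ^ 2 / (ε ^ 2 + s ^ 2)) i, cfc_predicate _ _, ?_, ?_, ?_⟩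
  · have h : 1 - cfc (fun s : ℝ => ε ^ 2 / (ε ^ 2 + s ^ 2)) i
        = i * cfc (fun s : ℝ => s / (ε ^ 2 + s ^ 2)) i := by
      have h1 : cfc (fun s : ℝ => (1 : ℝ)) i = 1 := cfc_const_one ℝ i
      have h2 : cfc (fun s : ℝ => s) i = i := cfc_id' ℝ i
      conv_lhs => rw [← h1]
      conv_rhs => rw [← h2]
      rw [h2]
      rw [← cfc_sub _ _ i (by fun_prop) hc.continuousOn]
      conv_rhs => enter [1]; rw [← h2]
      rw [← cfc_mul _ _ i (by fun_prop) hc2.continuousOn]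
      congr 1
      funext s
      have := (hpos s).ne'
      field_simp
      ring
    rw [h]
    exact hI.mul_right _ _ hi
  · refine norm_cfc_le zero_le_one fun s _ => ?_
    rw [Real.norm_of_nonneg (by have := hpos s; positivity), div_le_one (hpos s)]
    nlinarith [sq_nonneg s]
  · have h2 : cfc (fun s : ℝ => s) i = i := cfc_id' ℝ i
    have : cfc (fun s : ℝ => ε ^ 2 / (ε ^ 2 + s ^ 2)) i * i
        * cfc (fun s : ℝ => ε ^ 2 / (ε ^ 2 + s ^ 2)) i =
        cfc (fun s : ℝ => ε ^ 2 / (ε ^ 2 + s ^ 2) * s * (ε ^ 2 / (ε ^ 2 + s ^ 2))) i := by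
      rw [cfc_mul (fun s : ℝ => ε ^ 2 / (ε ^ 2 + s ^ 2) * s) _ i
          (hc.mul continuous_id).continuousOn hc.continuousOn,
        cfc_mul _ _ i hc.continuousOn (by fun_prop), h2]
    rw [this]
    refine norm_cfc_le hε.le fun s _ => ?_
    have h1 : |ε ^ 2 / (ε ^ 2 + s ^ 2)| ≤ 1 := by
      rw [abs_of_nonneg (by have := hpos s; positivity), div_le_one (hpos s)]
      nlinarith [sq_nonneg s]
    have h3 : |ε ^ 2 / (ε ^ 2 + s ^ 2) * s| ≤ ε := by
      rw [abs_mul, abs_of_nonneg (by have := hpos s; positivity), div_mul_eq_mul_div,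
        div_le_iff₀ (hpos s), ← sq_abs s]
      nlinarith [sq_nonneg (ε - |s|), abs_nonneg s]
    rw [Real.norm_eq_abs, abs_mul]
    calc _ ≤ ε * 1 := by gcongr
      _ = ε := mul_one _

theorem dist_aux (I : Submodule ℂ U) (hI : IdealLike I) (x i : U) (hi : i ∈ I) (t : ℝ)
    (ht : 0 ≤ t) (h : star x * x ≤ algebraMap ℝ U t + i) (ε : ℝ) (hε : 0 < ε) :
    ∃ j ∈ I, ‖x - j‖ ^ 2 ≤ t + ε := by
  have hsa : IsSelfAdjoint i := by
    have h1 : IsSelfAdjoint (algebraMap ℝ U t + i - star x * x) :=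
      IsSelfAdjoint.of_nonneg (sub_nonneg.2 h)
    have h2 : IsSelfAdjoint (star x * x) := IsSelfAdjoint.star_mul_self x
    have h3 : IsSelfAdjoint (algebraMap ℝ U t) := IsSelfAdjoint.algebraMap U (IsSelfAdjoint.all t)
    have := (h1.add h2).sub h3
    simpa using this
  obtain ⟨y, hy, hyI, hy1, hyi⟩ := approx_aux I hI i hi hsa ε hε
  refine ⟨x * (1 - y), hI.mul_left _ _ hyI, ?_⟩
  have e : x - x * (1 - y) = x * y := by noncomm_ring
  rw [e, sq, ← CStarRing.norm_star_mul_self]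
  have h4 : star (x * y) * (x * y) ≤ t • (y * y) + y * i * y := by
    have := IsSelfAdjoint.conjugate_le_conjugate h hy
    convert this using 1
    · rw [star_mul, hy.star_eq]; noncomm_ring
    · rw [Algebra.algebraMap_eq_smul_one]; simp [mul_add, add_mul]
  calc _ ≤ ‖t • (y * y) + y * i * y‖ :=
        CStarAlgebra.norm_le_norm_of_nonneg_of_le (star_mul_self_nonneg _) h4
    _ ≤ ‖t • (y * y)‖ + ‖y * i * y‖ := norm_add_le _ _
    _ ≤ t * (1 * 1) + ε := by
        gcongr
        rw [norm_smul, Real.norm_of_nonneg ht]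
        gcongr
        exact (norm_mul_le _ _).trans (by gcongr)
    _ = _ := by ring

theorem exists_state (I : Submodule ℂ U) (hI : IdealLike I) (x : U) (lam : ℝ) (hlam : 0 < lam)
    (hx : ∀ i ∈ I, lam ≤ ‖x - i‖) :
    ∃ φ : U →L[ℂ] ℂ, StateOn I φ ∧ lam ^ 2 ≤ (φ (star x * x)).re := by
  let C : Set U := {b | ∃ t : ℝ, 0 ≤ t ∧ t < lam ^ 2 ∧ ∃ i ∈ I,
    b + star b ≤ algebraMap ℝ U (2 * t) + i}
  have hlam2 : 0 < lam ^ 2 := by positivity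
  have hconv : Convex ℝ C := by
    rintro b ⟨t, ht0, ht, i, hi, hb⟩ c ⟨s, hs0, hs, j, hj, hc⟩ p q hp hq hpq
    refine ⟨p * t + q * s, by positivity, ?_, p • i + q • j,
      I.add_mem (I.smul_of_tower_mem p hi) (I.smul_of_tower_mem q hj), ?_⟩
    · have : p * t + q * s ≤ max t s := by
        calc _ ≤ p * max t s + q * max t s := by
              gcongr
              · exact le_max_left _ _
              · exact le_max_right _ _
          _ = _ := by rw [← add_mul, hpq, one_mul]
      exact this.trans_lt (max_lt ht hs)
    · have := add_le_add (smul_le_smul_of_nonneg_left hb hp) (smul_le_smul_of_nonneg_left hc hq)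
      convert this using 1
      · simp only [star_add, star_smul, star_trivial, smul_add]; abel
      · simp only [Algebra.algebraMap_eq_smul_one, smul_add, smul_smul, mul_add, add_smul]
        rw [show 2 * (p * t) = p * (2 * t) by ring, show 2 * (q * s) = q * (2 * s) by ring]
        abel
  have hopen : IsOpen C := by
    rw [Metric.isOpen_iff]
    rintro b ⟨t, ht0, ht, i, hi, hb⟩
    refine ⟨(lam ^ 2 - t) , by linarith, fun c hc => ?_⟩
    rw [Metric.mem_ball, dist_eq_norm] at hc
    refine ⟨t + ‖c - b‖, by positivity, by linarith, i, hi, ?_⟩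
    have hsa : IsSelfAdjoint ((c - b) + star (c - b)) := IsSelfAdjoint.add_star_self _
    have h1 := hsa.le_algebraMap_norm_self
    have h2 : ‖(c - b) + star (c - b)‖ ≤ 2 * ‖c - b‖ := by
      refine (norm_add_le _ _).trans ?_
      rw [norm_star]; linarith
    have h3 := h1.trans (algebraMap_mono U h2)
    have := add_le_add hb h3
    convert this using 1
    · rw [star_sub]; abel
    · rw [mul_add, map_add]; abel
  have hnot : star x * x ∉ C := by
    rintro ⟨t, ht0, ht, i, hi, h⟩
    have h' : star x * x ≤ algebraMap ℝ U t + (2⁻¹ : ℝ) • i := by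
      have := smul_le_smul_of_nonneg_left h (show (0 : ℝ) ≤ 2⁻¹ by norm_num)
      convert this using 1
      · rw [(IsSelfAdjoint.star_mul_self x).star_eq, ← two_smul ℝ, smul_smul]; norm_num
      · rw [smul_add, Algebra.algebraMap_eq_smul_one, Algebra.algebraMap_eq_smul_one, smul_smul]
        congr 2; ring
    obtain ⟨j, hj, hj2⟩ := dist_aux I hI x _ (I.smul_of_tower_mem _ hi) t ht0 h'
      ((lam ^ 2 - t) / 2) (by linarith)
    have := hx j hj
    nlinarith
  obtain ⟨f, hf⟩ := RCLike.geometric_hahn_banach_open_point (𝕜 := ℂ) hconv hopen hnot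
  simp only [RCLike.re_eq_complex_re] at hf
  -- a set closed under nonnegative scalings gives nonpositive values
  have cone : ∀ b : U, (∀ r : ℝ, 0 ≤ r → r • b ∈ C) → (f b).re ≤ 0 := by
    intro b hb
    by_contra! hpos
    have := hf _ (hb ((|(f (star x * x)).re|) / (f b).re) (by positivity))
    rw [ContinuousLinearMap.map_smul_of_tower, Complex.real_smul, Complex.re_ofReal_mul,
      div_mul_cancel₀ _ hpos.ne'] at this
    exact absurd this (not_lt.2 (le_abs_self _))
  have hneg : ∀ b : U, 0 ≤ b → 0 ≤ (f b).re := by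
    intro b hb
    have := cone (-b) fun r hr => ⟨0, le_rfl, hlam2, 0, I.zero_mem, by
      have h1 : 0 ≤ r • b := smul_nonneg hr hb
      have h2 : star b = b := (IsSelfAdjoint.of_nonneg hb).star_eq
      simp only [smul_neg, star_neg, star_smul, star_trivial, h2, mul_zero, map_zero, add_zero]
      exact add_nonpos (neg_nonpos.2 h1) (neg_nonpos.2 h1)⟩
    simpa using this
  have hskew : ∀ b : U, star b = -b → (f b).re ≤ 0 := by
    intro b hb
    refine cone b fun r hr => ⟨0, le_rfl, hlam2, 0, I.zero_mem, ?_⟩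
    simp [hb]
  have hId : ∀ i ∈ I, (f i).re ≤ 0 := by
    intro i hi
    refine cone i fun r hr => ⟨0, le_rfl, hlam2, r • i + star (r • i), ?_, ?_⟩
    · exact I.add_mem (I.smul_of_tower_mem _ hi) (hI.star_mem _ (I.smul_of_tower_mem _ hi))
    · simp
  have hvan : ∀ i ∈ I, f i = 0 := by
    intro i hi
    have a1 := hId i hi
    have a2 := hId (-i) (I.neg_mem hi)
    have a3 := hId (Complex.I • i) (I.smul_mem _ hi)
    have a4 := hId (-(Complex.I • i)) (I.neg_mem (I.smul_mem _ hi))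
    simp at a1 a2 a3 a4
    apply Complex.ext <;> simp <;> linarith
  have hreal : ∀ b : U, IsSelfAdjoint b → (f b).im = 0 := by
    intro b hb
    have a3 := hskew (Complex.I • b) (by simp [hb.star_eq])
    have a4 := hskew (-(Complex.I • b)) (by simp [hb.star_eq])
    simp at a3 a4
    linarith
  have hfpos : ∀ b : U, 0 ≤ b → 0 ≤ f b := fun b hb => by
    rw [Complex.le_def]
    exact ⟨by simpa using hneg b hb, by simpa using (hreal b (.of_nonneg hb)).symm⟩
  have hone : ∀ t : ℝ, 0 ≤ t → t < lam ^ 2 → t * (f 1).re < (f (star x * x)).re := by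
    intro t ht0 ht
    have := hf (algebraMap ℝ U t) ⟨t, ht0, ht, 0, I.zero_mem, by
      have h3 : IsSelfAdjoint (algebraMap ℝ U t) :=
        IsSelfAdjoint.algebraMap U (IsSelfAdjoint.all t)
      rw [h3.star_eq, add_zero, two_mul, map_add]⟩
    rw [Algebra.algebraMap_eq_smul_one, ContinuousLinearMap.map_smul_of_tower,
      Complex.real_smul, Complex.re_ofReal_mul] at this
    exact this
  have ha0 : 0 < (f (star x * x)).re := by simpa using hone 0 le_rfl hlam2
  have h1pos : 0 < (f 1).re := by
    have h := sub_nonneg.2 (IsSelfAdjoint.star_mul_self x).le_algebraMap_norm_self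
    have h2 := hneg _ h
    rw [Algebra.algebraMap_eq_smul_one, map_sub, ContinuousLinearMap.map_smul_of_tower,
      Complex.real_smul, Complex.sub_re, Complex.re_ofReal_mul] at h2
    by_contra! hcon
    nlinarith [norm_nonneg (star x * x)]
  have h1eq : f 1 = ((f 1).re : ℂ) :=
    Complex.ext (by simp) (by simpa using hreal 1 (IsSelfAdjoint.one U))
  have hle : lam ^ 2 * (f 1).re ≤ (f (star x * x)).re := by
    by_contra! hcon
    have h2 : (f (star x * x)).re / (f 1).re < lam ^ 2 := by rwa [div_lt_iff₀ h1pos]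
    have := hone _ (by positivity) h2
    rw [div_mul_cancel₀ _ h1pos.ne'] at this
    exact lt_irrefl _ this
  refine ⟨(((f 1).re⁻¹ : ℝ) : ℂ) • f, ⟨?_, ?_, ?_⟩, ?_⟩
  · rw [smul_apply, h1eq]
    simp [h1pos.ne']
  · intro b
    rw [smul_apply, smul_eq_mul]
    refine mul_nonneg ?_ (hfpos _ (star_mul_self_nonneg b))
    exact_mod_cast (inv_pos.2 h1pos).le
  · intro i hi; simp [hvan i hi]
  · rw [smul_apply, smul_eq_mul, Complex.re_ofReal_mul, inv_mul_eq_div,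
      le_div_iff₀ h1pos]
    exact hle

theorem inner_self_cast {H : Type} [NormedAddCommGroup H] [InnerProductSpace ℂ H] (v : H) :
    ⟪v, v⟫_ℂ = ((‖v‖ ^ 2 : ℝ) : ℂ) := by
  rw [inner_self_eq_norm_sq_to_K]; push_cast; rfl

theorem StateOn.nonneg {I : Submodule ℂ U} {φ : U → ℂ} (h : StateOn I φ) (b : U) (hb : 0 ≤ b) :
    0 ≤ φ b := by
  obtain ⟨c, rfl⟩ := CStarAlgebra.nonneg_iff_eq_star_mul_self.1 hb
  exact h.pos c

/-- the positive linear map of a state -/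
noncomputable def stateMap (I : Submodule ℂ U) (φ : U →L[ℂ] ℂ) (h : StateOn I φ) : U →ₚ[ℂ] ℂ :=
  PositiveLinearMap.mk₀ (φ : U →ₗ[ℂ] ℂ) (fun b hb => h.nonneg b hb)

theorem stateMap_apply (I : Submodule ℂ U) (φ : U →L[ℂ] ℂ) (h : StateOn I φ) (b : U) :
    stateMap I φ h b = φ b := rfl

/-- the cyclic vector -/
noncomputable def cyc (f : U →ₚ[ℂ] ℂ) : f.GNS := ((f.toPreGNS 1 : f.PreGNS) : f.GNS)

theorem gns_cyc (f : U →ₚ[ℂ] ℂ) (b : U) :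
    f.gnsStarAlgHom b (cyc f) = ((f.toPreGNS b : f.PreGNS) : f.GNS) := by
  have : f.gnsNonUnitalStarAlgHom b (cyc f) = ((f.toPreGNS b : f.PreGNS) : f.GNS) := by
    rw [cyc, PositiveLinearMap.gnsNonUnitalStarAlgHom_apply_coe]
    simp
  exact this

theorem gns_dense (f : U →ₚ[ℂ] ℂ) : DenseRange fun b : U => f.gnsStarAlgHom b (cyc f) := by
  have h : DenseRange ((↑) : f.PreGNS → f.GNS) := UniformSpace.Completion.denseRange_coe
  have h2 : Function.Surjective f.toPreGNS := f.toPreGNS.surjective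
  have : (fun b : U => f.gnsStarAlgHom b (cyc f)) = ((↑) : f.PreGNS → f.GNS) ∘ f.toPreGNS := by
    funext b; exact gns_cyc f b
  rw [this]
  exact h.comp h2.denseRange (UniformSpace.Completion.continuous_coe _)

theorem gns_inner (f : U →ₚ[ℂ] ℂ) (b c : U) :
    ⟪f.gnsStarAlgHom b (cyc f), f.gnsStarAlgHom c (cyc f)⟫_ℂ = f (star b * c) := by
  rw [gns_cyc, gns_cyc, UniformSpace.Completion.inner_coe, PositiveLinearMap.preGNS_inner_def]
  simp

theorem gns_inner_one (f : U →ₚ[ℂ] ℂ) (c : U) :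
    ⟪cyc f, f.gnsStarAlgHom c (cyc f)⟫_ℂ = f c := by
  have := gns_inner f 1 c
  simpa only [map_one, star_one, one_mul, one_apply_eq_self] using this

theorem rep_norm_le {H : Type} [NormedAddCommGroup H] [InnerProductSpace ℂ H] [CompleteSpace H]
    (π : U →⋆ₐ[ℂ] (H →L[ℂ] H)) (b : U) : ‖π b‖ ≤ ‖b‖ :=
  NonUnitalStarAlgHom.norm_apply_le π b

theorem state_norm (I : Submodule ℂ U) (φ : U →L[ℂ] ℂ) (h : StateOn I φ) : ‖φ‖ ≤ 1 := by
  refine φ.opNorm_le_bound zero_le_one fun b => ?_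
  let f := stateMap I φ h
  have h1 : φ b = ⟪cyc f, f.gnsStarAlgHom b (cyc f)⟫_ℂ := (gns_inner_one f b).symm
  have hc : ‖cyc f‖ ^ 2 = 1 := by
    have h3 := gns_inner_one f 1
    rw [map_one, one_apply_eq_self, inner_self_cast] at h3
    have h4 : f 1 = 1 := h.one
    rw [h4] at h3
    exact_mod_cast h3
  have hc1 : ‖cyc f‖ = 1 := by nlinarith [norm_nonneg (cyc f)]
  rw [h1, one_mul]
  calc _ ≤ ‖cyc f‖ * ‖f.gnsStarAlgHom b (cyc f)‖ := norm_inner_le_norm _ _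
    _ ≤ ‖cyc f‖ * (‖f.gnsStarAlgHom b‖ * ‖cyc f‖) := by
        gcongr; exact ContinuousLinearMap.le_opNorm _ _
    _ = ‖f.gnsStarAlgHom b‖ := by rw [hc1]; ring
    _ ≤ _ := rep_norm_le _ b

theorem weakDual_lc : LocallyConvexSpace ℝ (WeakDual ℂ U) := by
  let L : WeakDual ℂ U →ₗ[ℝ] (U → ℂ) :=
    { toFun := fun φ b => φ b
      map_add' := fun _ _ => rfl
      map_smul' := fun _ _ => rfl }
  exact LocallyConvexSpace.induced L

theorem exists_pure (I : Submodule ℂ U) (a : U) (φ₀ : U →L[ℂ] ℂ) (h₀ : StateOn I φ₀) :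
    ∃ φ : U →L[ℂ] ℂ, StateOn I φ ∧ (φ₀ a).re ≤ (φ a).re ∧
      ∀ ψ₁ ψ₂ : U →L[ℂ] ℂ, StateOn I ψ₁ → StateOn I ψ₂ → ∀ t : ℝ, 0 < t → t < 1 →
        (∀ b, φ b = t * ψ₁ b + (1 - t : ℝ) * ψ₂ b) → ψ₁ = φ := by
  have := weakDual_lc (U := U)
  let K : Set (WeakDual ℂ U) := {φ | StateOn I φ}
  have hK : IsCompact K := by
    refine (WeakDual.isCompact_closedBall (𝕜 := ℂ) (E := U) 0 1).of_isClosed_subset ?_ ?_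
    · have : K = {φ : WeakDual ℂ U | φ 1 = 1} ∩ ((⋂ b : U, {φ : WeakDual ℂ U | 0 ≤ φ (star b * b)})
          ∩ (⋂ i ∈ I, {φ : WeakDual ℂ U | φ i = 0})) := by
        ext φ
        simp only [Set.mem_inter_iff, Set.mem_iInter, Set.mem_ofPred_eq, K]
        exact ⟨fun h => ⟨h.one, h.pos, h.van⟩, fun h => ⟨h.1, h.2.1, h.2.2⟩⟩
      rw [this]
      have ev : ∀ b : U, Continuous fun φ : WeakDual ℂ U => φ b := WeakDual.eval_continuous
      refine (isClosed_eq (ev 1) continuous_const).inter (IsClosed.inter ?_ ?_)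
      · exact isClosed_iInter fun b => isClosed_le continuous_const (ev _)
      · exact isClosed_biInter fun i _ => isClosed_eq (ev _) continuous_const
    · intro φ hφ
      simp only [Set.mem_preimage, mem_closedBall_zero_iff]
      exact state_norm I (WeakDual.toStrongDual φ) hφ
  have evr : Continuous fun φ : WeakDual ℂ U => (φ a).re :=
    Complex.continuous_re.comp (WeakDual.eval_continuous a)
  obtain ⟨m, hmK, hm⟩ := hK.exists_isMaxOn (f := fun φ : WeakDual ℂ U => (φ a).re)
    ⟨StrongDual.toWeakDual φ₀, h₀⟩ evr.continuousOn
  have hm' : ∀ ψ : WeakDual ℂ U, ψ ∈ K → (ψ a).re ≤ (m a).re := fun ψ hψ => hm hψ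
  let F : Set (WeakDual ℂ U) := K ∩ {φ | (φ a).re = (m a).re}
  have hF : IsCompact F := hK.inter_right (isClosed_eq evr continuous_const)
  obtain ⟨φ, hφ⟩ := hF.extremePoints_nonempty ⟨m, hmK, rfl⟩
  rw [mem_extremePoints] at hφ
  obtain ⟨⟨hφK, hφm⟩, hext⟩ := hφ
  simp only [Set.mem_ofPred_eq] at hφm
  refine ⟨WeakDual.toStrongDual φ, hφK, ?_, ?_⟩
  · have := hm' (StrongDual.toWeakDual φ₀) h₀
    rw [← hφm] at this
    exact this
  · intro ψ₁ ψ₂ h1 h2 t ht0 ht1 hb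
    have k1 := hm' (StrongDual.toWeakDual ψ₁) h1
    have k2 := hm' (StrongDual.toWeakDual ψ₂) h2
    have k3 : φ a = t * ψ₁ a + (1 - t : ℝ) * ψ₂ a := hb a
    have k3' := congrArg Complex.re k3
    rw [Complex.add_re, Complex.re_ofReal_mul, Complex.re_ofReal_mul, hφm] at k3'
    have k1' : (ψ₁ a).re ≤ (m a).re := k1
    have k2' : (ψ₂ a).re ≤ (m a).re := k2
    have e1 : (ψ₁ a).re = (m a).re := by
      apply le_antisymm k1'
      by_contra! hlt
      nlinarith
    have e2 : (ψ₂ a).re = (m a).re := by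
      apply le_antisymm k2'
      by_contra! hlt
      nlinarith
    have := (hext (StrongDual.toWeakDual ψ₁) ⟨h1, e1⟩ (StrongDual.toWeakDual ψ₂) ⟨h2, e2⟩
      ⟨t, 1 - t, ht0, by linarith, by ring, ?_⟩).1
    · rw [← this]; rfl
    · refine ContinuousLinearMap.ext fun b => ?_
      refine Eq.trans ?_ (hb b).symm
      rfl

theorem pure_irreducible (I : Submodule ℂ U) (φ : U →L[ℂ] ℂ) (h : StateOn I φ)
    (hI : IdealLike I)
    (hp : ∀ ψ₁ ψ₂ : U →L[ℂ] ℂ, StateOn I ψ₁ → StateOn I ψ₂ → ∀ t : ℝ, 0 < t → t < 1 →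
        (∀ b, φ b = t * ψ₁ b + (1 - t : ℝ) * ψ₂ b) → ψ₁ = φ)
    {H : Type} [NormedAddCommGroup H] [InnerProductSpace ℂ H] [CompleteSpace H]
    (π : U →⋆ₐ[ℂ] (H →L[ℂ] H)) (ξ : H) (hd : DenseRange fun b : U => π b ξ)
    (hin : ∀ b, ⟪ξ, π b ξ⟫_ℂ = φ b) :
    (∀ i ∈ I, π i = 0) ∧ ∀ V : Submodule ℂ H, IsClosed (V : Set H) →
      (∀ b, ∀ v ∈ V, π b v ∈ V) → V = ⊥ ∨ V = ⊤ := by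
  have hadj : ∀ (b : U) (v w : H), ⟪π (star b) v, w⟫_ℂ = ⟪v, π b w⟫_ℂ := by
    intro b v w
    rw [map_star, ContinuousLinearMap.star_eq_adjoint, ContinuousLinearMap.adjoint_inner_left]
  have hmul : ∀ (b c : U) (v : H), π (b * c) v = π b (π c v) := by
    intro b c v; rw [map_mul]; rfl
  have hker : ∀ i ∈ I, π i = 0 := by
    intro i hi
    have h1 : ∀ c, π i (π c ξ) = 0 := by
      intro c
      rw [← hmul, ← inner_self_eq_zero (𝕜 := ℂ), ← hadj, ← inner_conj_symm, ← hmul, hin,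
        h.van _ (hI.mul_left _ _ (hI.mul_right _ _ hi)), map_zero]
    have h2 : (fun v => π i v) = fun v => (0 : H) :=
      hd.equalizer (π i).continuous continuous_const (funext h1)
    exact ContinuousLinearMap.ext fun v => congrFun h2 v
  refine ⟨hker, fun V hV hinv => ?_⟩
  have hVc : CompleteSpace V := hV.completeSpace_coe
  have horth : ∀ b, ∀ v ∈ Vᗮ, π b v ∈ Vᗮ := by
    intro b v hv
    rw [Submodule.mem_orthogonal] at hv ⊢
    intro u hu
    rw [← hadj]
    exact hv _ (hinv _ _ hu)
  have hcomm : ∀ b v, V.starProjection (π b v) = π b (V.starProjection v) := by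
    intro b v
    refine Submodule.eq_starProjection_of_mem_orthogonal (hinv _ _ (V.starProjection_apply_mem v)) ?_
    rw [← map_sub]
    exact horth _ _ (V.sub_starProjection_mem_orthogonal v)
  obtain ⟨η, hη⟩ : ∃ η, η = V.starProjection ξ := ⟨_, rfl⟩
  obtain ⟨ζ, hζ⟩ : ∃ ζ, ζ = ξ - η := ⟨_, rfl⟩
  have hηV : η ∈ V := hη ▸ V.starProjection_apply_mem ξ
  have hζV : ζ ∈ Vᗮ := by rw [hζ, hη]; exact V.sub_starProjection_mem_orthogonal ξ
  have hξ : ξ = η + ζ := by rw [hζ]; abel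
  have c1 : ∀ b, ⟪η, π b ζ⟫_ℂ = 0 := fun b =>
    (Submodule.mem_orthogonal _ _).1 (horth b _ hζV) _ hηV
  have c2 : ∀ b, ⟪ζ, π b η⟫_ℂ = 0 := fun b =>
    (Submodule.mem_orthogonal' _ _).1 hζV _ (hinv b _ hηV)
  by_cases hη0 : η = 0
  · left
    have h2 : (fun v => V.starProjection v) = fun v => (0 : H) :=
      hd.equalizer V.starProjection.continuous continuous_const (funext fun b => by
        simp only [Function.comp_apply]
        rw [hcomm, ← hη, hη0, map_zero])
    rw [eq_bot_iff]
    intro v hv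
    rw [← Submodule.starProjection_eq_self_iff] at hv
    rw [Submodule.mem_bot, ← hv]
    exact congrFun h2 v
  by_cases hζ0 : ζ = 0
  · right
    have h2 : (fun v => V.starProjection v) = fun v => v :=
      hd.equalizer V.starProjection.continuous continuous_id (funext fun b => by
        simp only [Function.comp_apply]
        rw [hcomm, ← hη, hξ, hζ0, add_zero])
    rw [eq_top_iff]
    intro v _
    rw [← Submodule.starProjection_eq_self_iff]
    exact congrFun h2 v
  exfalso
  have vs : ∀ u : H, u ≠ 0 → ∃ ψ : U →L[ℂ] ℂ, StateOn I ψ ∧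
      ∀ b, ((‖u‖ ^ 2 : ℝ) : ℂ) * ψ b = ⟪u, π b u⟫_ℂ := by
    intro u hu
    have hn : ‖u‖ ≠ 0 := norm_ne_zero_iff.2 hu
    have hn2 : ((‖u‖ ^ 2 : ℝ) : ℂ) ≠ 0 := by exact_mod_cast pow_ne_zero 2 hn
    let L : U →ₗ[ℂ] ℂ :=
      { toFun := fun b => ((‖u‖ ^ 2 : ℝ) : ℂ)⁻¹ * ⟪u, π b u⟫_ℂ
        map_add' := fun b c => by simp [inner_add_right, mul_add]
        map_smul' := fun r b => by simp [inner_smul_right]; ring }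
    refine ⟨L.mkContinuous 1 fun b => ?_, ⟨?_, ?_, ?_⟩, ?_⟩
    · change ‖((‖u‖ ^ 2 : ℝ) : ℂ)⁻¹ * ⟪u, π b u⟫_ℂ‖ ≤ 1 * ‖b‖
      rw [norm_mul, norm_inv, Complex.norm_real, Real.norm_of_nonneg (by positivity), one_mul,
        inv_mul_le_iff₀ (by positivity)]
      calc _ ≤ ‖u‖ * ‖π b u‖ := norm_inner_le_norm _ _
        _ ≤ ‖u‖ * (‖b‖ * ‖u‖) := by
            gcongr
            exact (ContinuousLinearMap.le_opNorm _ _).trans (by gcongr; exact rep_norm_le π b)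
        _ = _ := by ring
    · change ((‖u‖ ^ 2 : ℝ) : ℂ)⁻¹ * ⟪u, π 1 u⟫_ℂ = 1
      rw [map_one, one_apply_eq_self, inner_self_cast]
      rw [inv_mul_cancel₀ hn2]
    · intro b
      change 0 ≤ ((‖u‖ ^ 2 : ℝ) : ℂ)⁻¹ * ⟪u, π (star b * b) u⟫_ℂ
      rw [hmul, ← hadj, star_star, inner_self_cast]
      have : (0 : ℝ) ≤ (‖u‖ ^ 2)⁻¹ * ‖π b u‖ ^ 2 := by positivity
      have h' : (0 : ℂ) ≤ (((‖u‖ ^ 2)⁻¹ * ‖π b u‖ ^ 2 : ℝ) : ℂ) := by exact_mod_cast this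
      push_cast at h' ⊢
      exact h'
    · intro i hi
      change ((‖u‖ ^ 2 : ℝ) : ℂ)⁻¹ * ⟪u, π i u⟫_ℂ = 0
      rw [hker i hi]; simp
    · intro b
      change ((‖u‖ ^ 2 : ℝ) : ℂ) * (((‖u‖ ^ 2 : ℝ) : ℂ)⁻¹ * ⟪u, π b u⟫_ℂ) = _
      rw [mul_inv_cancel_left₀ hn2]
  obtain ⟨ψ₁, s1, e1⟩ := vs η hη0
  obtain ⟨ψ₂, s2, e2⟩ := vs ζ hζ0
  have hsum : ∀ b, φ b = ⟪η, π b η⟫_ℂ + ⟪ζ, π b ζ⟫_ℂ := by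
    intro b
    rw [← hin b, hξ, map_add, inner_add_left, inner_add_right, inner_add_right, c1, c2]
    ring
  have p1 : 0 < ‖η‖ ^ 2 := by have := norm_pos_iff.2 hη0; positivity
  have p2 : 0 < ‖ζ‖ ^ 2 := by have := norm_pos_iff.2 hζ0; positivity
  have htot : ‖η‖ ^ 2 + ‖ζ‖ ^ 2 = 1 := by
    have := hsum 1
    rw [← e1, ← e2, h.one, s1.one, s2.one, mul_one, mul_one] at this
    exact_mod_cast this.symm
  have hψ : ψ₁ = φ := by
    refine hp ψ₁ ψ₂ s1 s2 (‖η‖ ^ 2) p1 (by linarith) fun b => ?_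
    rw [e1, show 1 - ‖η‖ ^ 2 = ‖ζ‖ ^ 2 by linarith, e2, hsum]
  have hz : ∀ b, ⟪η - ((‖η‖ ^ 2 : ℝ) : ℂ) • ξ, π b ξ⟫_ℂ = 0 := by
    intro b
    have a1 : ⟪η, π b ξ⟫_ℂ = ⟪η, π b η⟫_ℂ := by
      conv_lhs => rw [hξ]
      rw [map_add, inner_add_right, c1, add_zero]
    rw [inner_sub_left, inner_smul_left, hin, a1, ← e1, hψ, Complex.conj_ofReal, sub_self]
  have hz2 : (fun v => ⟪η - ((‖η‖ ^ 2 : ℝ) : ℂ) • ξ, v⟫_ℂ) = fun _ => (0 : ℂ) :=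
    hd.equalizer (by fun_prop) continuous_const (funext hz)
  have hz3 : η - ((‖η‖ ^ 2 : ℝ) : ℂ) • ξ = 0 :=
    inner_self_eq_zero.1 (congrFun hz2 (η - ((‖η‖ ^ 2 : ℝ) : ℂ) • ξ))
  have b1 : ⟪η - ((‖η‖ ^ 2 : ℝ) : ℂ) • ξ, ζ⟫_ℂ = 0 := by rw [hz3, inner_zero_left]
  have b2 := c1 1
  rw [map_one, one_apply_eq_self] at b2
  rw [inner_sub_left, inner_smul_left, b2, hξ, inner_add_left, b2, inner_self_cast,
    Complex.conj_ofReal, zero_add, zero_sub, neg_eq_zero] at b1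
  have b3 : ‖η‖ ^ 2 * ‖ζ‖ ^ 2 = 0 := by exact_mod_cast b1
  exact (mul_pos p1 p2).ne' b3

theorem exists_irrep (I : Submodule ℂ U) (hI : IdealLike I) (x : U) (lam : ℝ) (hlam : 0 < lam)
    (hx : ∀ i ∈ I, lam ≤ ‖x - i‖) :
    ∃ f : U →ₚ[ℂ] ℂ, (∀ i ∈ I, f.gnsStarAlgHom i = 0) ∧ lam ≤ ‖f.gnsStarAlgHom x‖ ∧
      ∀ V : Submodule ℂ f.GNS, IsClosed (V : Set f.GNS) →
      (∀ b, ∀ v ∈ V, f.gnsStarAlgHom b v ∈ V) → V = ⊥ ∨ V = ⊤ := by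
  obtain ⟨φ₀, h₀, hle⟩ := exists_state I hI x lam hlam hx
  obtain ⟨φ, h, hle2, hp⟩ := exists_pure I (star x * x) φ₀ h₀
  let f := stateMap I φ h
  obtain ⟨k1, k2⟩ := pure_irreducible I φ h hI hp f.gnsStarAlgHom (cyc f) (gns_dense f)
    (gns_inner_one f)
  refine ⟨f, k1, ?_, k2⟩
  have hc : ‖cyc f‖ ^ 2 = 1 := by
    have h3 := gns_inner_one f 1
    rw [map_one, one_apply_eq_self, inner_self_cast] at h3
    have h4 : f 1 = 1 := h.one
    rw [h4] at h3
    exact_mod_cast h3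
  have hc1 : ‖cyc f‖ = 1 := by nlinarith [norm_nonneg (cyc f)]
  have h5 : ‖f.gnsStarAlgHom x (cyc f)‖ ^ 2 = (φ (star x * x)).re := by
    have h6 : f (star x * x) = φ (star x * x) := rfl
    rw [← h6, ← gns_inner, inner_self_cast]
    exact (Complex.ofReal_re _).symm
  have h7 : ‖f.gnsStarAlgHom x (cyc f)‖ ≤ ‖f.gnsStarAlgHom x‖ := by
    have := (f.gnsStarAlgHom x).le_opNorm (cyc f)
    rwa [hc1, mul_one] at this
  refine le_trans ?_ h7
  exact le_of_sq_le_sq (by linarith) (norm_nonneg _)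

end unital

theorem rep_norm_le' {A : Type} [NonUnitalCStarAlgebra A] {H : Type} [NormedAddCommGroup H]
    [InnerProductSpace ℂ H] [CompleteSpace H] (π : A →⋆ₙₐ[ℂ] (H →L[ℂ] H)) (b : A) :
    ‖π b‖ ≤ ‖b‖ :=
  NonUnitalStarAlgHom.norm_apply_le π b

/-- Nonunital version. -/
theorem exists_irrep_nonunital {A : Type} [NonUnitalCStarAlgebra A] (I : Submodule ℂ A)
    (hl : ∀ b, ∀ i ∈ I, b * i ∈ I) (hr : ∀ b, ∀ i ∈ I, i * b ∈ I) (hs : ∀ i ∈ I, star i ∈ I)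
    (x : A) (lam : ℝ) (hlam : 0 < lam) (hx : ∀ i ∈ I, lam ≤ ‖x - i‖) :
    ∃ ρ : HilbertRep A, ρ.IsIrreducible ∧ (∀ i ∈ I, ρ.π i = 0) ∧ lam ≤ ‖ρ.π x‖ := by
  letI : PartialOrder (Unitization ℂ A) := CStarAlgebra.spectralOrder _
  haveI : StarOrderedRing (Unitization ℂ A) := CStarAlgebra.spectralOrderedRing _
  let J : Submodule ℂ (Unitization ℂ A) := I.map (Unitization.inrHom ℂ ℂ A)
  have hJ : IdealLike J := by
    refine ⟨?_, ?_, ?_⟩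
    · rintro b _ ⟨i, hi, rfl⟩
      refine ⟨b.fst • i + b.snd * i, I.add_mem (I.smul_mem _ hi) (hl _ _ hi), ?_⟩
      ext <;> simp
    · rintro b _ ⟨i, hi, rfl⟩
      refine ⟨b.fst • i + i * b.snd, I.add_mem (I.smul_mem _ hi) (hr _ _ hi), ?_⟩
      ext <;> simp
    · rintro _ ⟨i, hi, rfl⟩
      refine ⟨star i, hs _ hi, ?_⟩
      ext <;> simp
  obtain ⟨f, hf1, hf2, hf3⟩ := exists_irrep J hJ (x : Unitization ℂ A) lam hlam (by
    rintro _ ⟨i, hi, rfl⟩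
    have := hx i hi
    rw [← Unitization.norm_inr (𝕜 := ℂ)] at this
    simpa using this)
  let π : A →⋆ₙₐ[ℂ] (f.GNS →L[ℂ] f.GNS) :=
    (f.gnsStarAlgHom : Unitization ℂ A →⋆ₙₐ[ℂ] (f.GNS →L[ℂ] f.GNS)).comp
      (Unitization.inrNonUnitalStarAlgHom ℂ A)
  have hπ : ∀ a : A, π a = f.gnsStarAlgHom (a : Unitization ℂ A) := fun _ => rfl
  refine ⟨⟨f.GNS, π⟩, ⟨?_, ?_⟩, ?_, hf2⟩
  · intro h0
    have h1 : π x = 0 := by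
      change π = 0 at h0
      rw [h0]; rfl
    rw [hπ] at h1
    rw [h1, norm_zero] at hf2
    linarith
  · intro V hV hinv
    refine hf3 V hV fun b v hv => ?_
    have hb : b = algebraMap ℂ (Unitization ℂ A) b.fst + (b.snd : Unitization ℂ A) := by
      ext <;> simp [Unitization.algebraMap_eq_inl]
    rw [hb, map_add, AlgHomClass.commutes, Algebra.algebraMap_eq_smul_one]
    exact V.add_mem (V.smul_mem _ hv) (hinv b.snd v hv)
  · intro i hi
    exact hf1 _ ⟨i, hi, rfl⟩

theorem le_infDist_ker {A : Type} [NonUnitalCStarAlgebra A] (ρ : HilbertRep A) (x : A) (lam : ℝ)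
    (h : lam ≤ ‖ρ.π x‖) : lam ≤ Metric.infDist x {a : A | ρ.π a = 0} := by
  have hne : {a : A | ρ.π a = 0}.Nonempty := ⟨0, map_zero ρ.π⟩
  refine (Metric.le_infDist hne).2 fun y hy => ?_
  have hy' : ρ.π y = 0 := hy
  have := rep_norm_le' ρ.π (x - y)
  rw [map_sub, hy', sub_zero] at this
  rw [dist_eq_norm]
  exact h.trans this

/-- For `x ∈ A` and `λ > 0`, the set `{J ∈ Prim(A) : ‖x + J‖ ≥ λ}` is compact
in the Jacobson topology (no Hausdorff property claimed). -/
theorem isCompact_quotientNorm_ge (x : A) (lam : ℝ) (hlam : 0 < lam) :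
    IsCompact {J : PrimSpace A | lam ≤ Metric.infDist x (J.1 : Set A)} := by
  letI : NonUnitalCStarAlgebra A := {}
  rw [isCompact_iff_ultrafilter_le_nhds]
  intro F hF
  rw [Filter.le_principal_iff] at hF
  have mem_iff : ∀ J : PrimSpace A, ∃ ρ : HilbertRep A, ∀ a, a ∈ J.1 ↔ ρ.π a = 0 := by
    rintro ⟨P, ρ, hρ, rfl⟩
    exact ⟨ρ, fun a => Iff.rfl⟩
  let I : Submodule ℂ A :=
    { carrier := {a | ∀ᶠ J in (F : Filter (PrimSpace A)), a ∈ J.1}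
      add_mem' := fun {a b} ha hb => by
        filter_upwards [ha, hb] with J h1 h2
        obtain ⟨ρ, h⟩ := mem_iff J
        rw [h] at h1 h2 ⊢
        rw [map_add, h1, h2, add_zero]
      zero_mem' := Filter.Eventually.of_forall fun J => by
        obtain ⟨ρ, h⟩ := mem_iff J
        rw [h, map_zero]
      smul_mem' := fun c a ha => by
        filter_upwards [ha] with J h1
        obtain ⟨ρ, h⟩ := mem_iff J
        rw [h] at h1 ⊢
        rw [map_smul, h1, smul_zero] }
  have hI : ∀ a, a ∈ I ↔ ∀ᶠ J in (F : Filter (PrimSpace A)), a ∈ J.1 := fun a => Iff.rfl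
  obtain ⟨ρ, hirr, hker, hnorm⟩ := exists_irrep_nonunital I
    (by
      intro b i hi
      rw [hI] at hi ⊢
      filter_upwards [hi] with J h1
      obtain ⟨ρ, h⟩ := mem_iff J
      rw [h] at h1 ⊢
      rw [map_mul, h1, mul_zero])
    (by
      intro b i hi
      rw [hI] at hi ⊢
      filter_upwards [hi] with J h1
      obtain ⟨ρ, h⟩ := mem_iff J
      rw [h] at h1 ⊢
      rw [map_mul, h1, zero_mul])
    (by
      intro i hi
      rw [hI] at hi ⊢
      filter_upwards [hi] with J h1
      obtain ⟨ρ, h⟩ := mem_iff J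
      rw [h] at h1 ⊢
      rw [map_star, h1, star_zero])
    x lam hlam (by
      intro i hi
      rw [hI] at hi
      obtain ⟨J, h1, h2⟩ := (hi.and hF).exists
      have h2' : lam ≤ Metric.infDist x J.1 := h2
      rw [← dist_eq_norm]
      exact h2'.trans (Metric.infDist_le_dist_of_mem h1))
  refine ⟨⟨{a : A | ρ.π a = 0}, ρ, hirr, rfl⟩, le_infDist_ker ρ x lam hnorm, ?_⟩
  refine le_trans ?_ TopologicalSpace.nhds_generateFrom.ge
  refine le_iInf₂ ?_
  rintro _ ⟨hP, S, rfl⟩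
  rw [Filter.le_principal_iff]
  have hP' : ¬ S ⊆ {a : A | ρ.π a = 0} := hP
  obtain ⟨s, hsS, hs⟩ := Set.not_subset.1 hP'
  have hsI : ¬ ∀ᶠ J in (F : Filter (PrimSpace A)), s ∈ J.1 := fun h => hs (hker s h)
  rw [← Ultrafilter.eventually_not] at hsI
  filter_upwards [hsI] with J hJ hS
  exact hJ (hS hsS)
end

section
/- Let A be a C*-algebra and I a closed ideal of A. Then Prim(I⊥) = Prim(A) \ closure(Prim(I)), where I⊥ is the annihilator of I in A and Prim(I) is identified with {J ∈ Prim(A) : I ⊄ J}. -/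
variable {A : Type} [NonUnitalNormedRing A] [StarRing A] [CStarRing A]
  [NormedSpace ℂ A] [IsScalarTower ℂ A A] [SMulCommClass ℂ A A]
  [StarModule ℂ A] [CompleteSpace A]

/-- The annihilator `I⊥ = {a : aI = Ia = 0}` of an ideal `I`. -/
def annihilatorSet (I : TwoSidedIdeal A) : Set A :=
  {a : A | ∀ b ∈ I, a * b = 0 ∧ b * a = 0}

section helper
open scoped ComplexOrder InnerProductSpace

theorem aux_irred {B H : Type} [CStarAlgebra B] [NormedAddCommGroup H] [InnerProductSpace ℂ H]
    [CompleteSpace H] (π : B →⋆ₙₐ[ℂ] (H →L[ℂ] H)) (ξ : H) (φ : B →L[ℂ] ℂ)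
    (hφ : ∀ b, φ b = ⟪ξ, π b ξ⟫_ℂ) (hξ : ‖ξ‖ = 1)
    (hd : Dense (Set.range fun b => π b ξ))
    (hext : ∀ φ₁ φ₂ : B →L[ℂ] ℂ, ‖φ₁‖ ≤ 1 → ‖φ₂‖ ≤ 1 → ∀ t : ℝ, 0 < t → t < 1 →
      (t • φ₁ + (1 - t) • φ₂ = φ) → φ₁ = φ)
    (V : Submodule ℂ H) (hV : IsClosed (V : Set H)) (hinv : ∀ b, ∀ v ∈ V, π b v ∈ V) :
    V = ⊥ ∨ V = ⊤ := by
  have : CompleteSpace V := hV.completeSpace_coe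
  have hstar : ∀ b x y, ⟪x, π b y⟫_ℂ = ⟪π (star b) x, y⟫_ℂ := by
    intro b x y
    rw [map_star, ContinuousLinearMap.star_eq_adjoint, ContinuousLinearMap.adjoint_inner_left]
  have hinv' : ∀ b, ∀ v ∈ Vᗮ, π b v ∈ Vᗮ := by
    intro b v hv
    rw [Submodule.mem_orthogonal] at hv ⊢
    intro u hu
    rw [hstar]
    exact hv _ (hinv _ _ hu)
  have key : ∀ W : Submodule ℂ H, IsClosed (W : Set H) → (∀ b, ∀ v ∈ W, π b v ∈ W) → ξ ∈ W →
      W = ⊤ := by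
    intro W hW hi hx
    rw [eq_top_iff]
    intro y _
    have : closure (Set.range fun b => π b ξ) ⊆ W :=
      closure_minimal (by rintro _ ⟨b, rfl⟩; exact hi b _ hx) hW
    exact this (hd y)
  obtain ⟨u, hu, w, hw, huw⟩ := V.exists_add_mem_mem_orthogonal ξ
  by_cases hu0 : u = 0
  · left
    have : Vᗮ = ⊤ := key _ V.isClosed_orthogonal hinv' (by rw [huw, hu0, zero_add]; exact hw)
    exact (Submodule.orthogonal_eq_top_iff V).1 this
  by_cases hw0 : w = 0
  · right
    exact key _ hV hinv (by rw [huw, hw0, add_zero]; exact hu)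
  right
  have hn : ‖u‖ ^ 2 + ‖w‖ ^ 2 = 1 := by
    have := norm_add_sq_eq_norm_sq_add_norm_sq_of_inner_eq_zero u w
      (Submodule.inner_right_of_mem_orthogonal hu hw)
    rw [← huw, hξ] at this
    nlinarith
  have hup : 0 < ‖u‖ := norm_pos_iff.2 hu0
  have hwp : 0 < ‖w‖ := norm_pos_iff.2 hw0
  let vs : H → (B →L[ℂ] ℂ) := fun v => LinearMap.mkContinuous
    { toFun := fun b => ((‖v‖ ^ 2)⁻¹ : ℝ) • ⟪v, π b v⟫_ℂ
      map_add' := by intro x y; simp [inner_add_right, mul_add]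
      map_smul' := by intro x y; simp [inner_smul_right]; ring } 1 (by
      intro b
      have h1 : ‖⟪v, π b v⟫_ℂ‖ ≤ ‖v‖ * (‖b‖ * ‖v‖) :=
        (norm_inner_le_norm _ _).trans (by
          gcongr
          exact (ContinuousLinearMap.le_opNorm _ _).trans (by
            gcongr; exact NonUnitalStarAlgHom.norm_apply_le π b))
      simp only [LinearMap.coe_mk, AddHom.coe_mk, norm_smul, one_mul]
      rcases eq_or_ne v 0 with rfl | hv
      · simp
      have hvp : 0 < ‖v‖ := norm_pos_iff.2 hv
      rw [Real.norm_of_nonneg (by positivity), inv_mul_le_iff₀ (by positivity)]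
      nlinarith)
  have hvs : ∀ v b, vs v b = ((‖v‖ ^ 2)⁻¹ : ℝ) • ⟪v, π b v⟫_ℂ := fun v b => rfl
  have hvn : ∀ v, ‖vs v‖ ≤ 1 := fun v => LinearMap.mkContinuous_norm_le _ zero_le_one _
  have e1 : ∀ b, ⟪u, π b ξ⟫_ℂ = ⟪u, π b u⟫_ℂ := by
    intro b
    rw [huw, map_add, inner_add_right,
      Submodule.inner_right_of_mem_orthogonal hu (hinv' b _ hw), add_zero]
  have e2 : ∀ b, ⟪w, π b ξ⟫_ℂ = ⟪w, π b w⟫_ℂ := by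
    intro b
    rw [huw, map_add, inner_add_right,
      Submodule.inner_left_of_mem_orthogonal (hinv b _ hu) hw, zero_add]
  have h := hext (vs u) (vs w) (hvn u) (hvn w) (‖u‖ ^ 2) (by positivity) (by nlinarith) (by
    ext b
    have : (1 - ‖u‖ ^ 2) = ‖w‖ ^ 2 := by linarith
    rw [this]
    simp only [add_apply, smul_apply, hvs, smul_smul]
    rw [mul_inv_cancel₀ (by positivity), mul_inv_cancel₀ (by positivity), one_smul, one_smul,
      hφ, ← e1, ← e2, ← inner_add_left, ← huw])
  have h0 : u - ((‖u‖ ^ 2 : ℝ) : ℂ) • ξ = 0 := by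
    refine Dense.eq_zero_of_inner_left (𝕜 := ℂ) hd ?_
    rintro _ ⟨b, rfl⟩
    have hb := congrArg (fun f => f b) h
    simp only [hvs, hφ, ← e1, Complex.real_smul] at hb
    rw [inner_sub_left, inner_smul_left, Complex.conj_ofReal, ← hb, ← mul_assoc,
      ← Complex.ofReal_mul, mul_inv_cancel₀ (by positivity)]
    simp
  apply key _ hV hinv
  have h2 : ξ = ((‖u‖ ^ 2 : ℝ) : ℂ)⁻¹ • u := by
    have hne : ((‖u‖ ^ 2 : ℝ) : ℂ) ≠ 0 := by
      exact_mod_cast (by positivity : (‖u‖ ^ 2) ≠ 0)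
    rw [eq_inv_smul_iff₀ hne]
    exact (sub_eq_zero.1 h0).symm
  rw [h2]
  exact V.smul_mem _ hu

theorem aux_pos {B : Type} [CStarAlgebra B] [PartialOrder B] [StarOrderedRing B]
    (φ : B →L[ℂ] ℂ) (hn : ‖φ‖ ≤ 1) (h1 : φ 1 = 1) (a : B) (ha : 0 ≤ a) : 0 ≤ φ a := by
  have : Nontrivial B := ⟨1, 0, fun h => by rw [h, map_zero] at h1; exact zero_ne_one h1⟩
  have hle : ∀ b, ‖φ b‖ ≤ ‖b‖ := fun b => φ.le_of_opNorm_le hn b |>.trans (by simp)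
  have hsa : IsSelfAdjoint a := .of_nonneg ha
  have him : (φ a).im = 0 := by
    have hk : ∀ t : ℝ, ((φ a).im + t) ^ 2 ≤ ‖a‖ ^ 2 + t ^ 2 := by
      intro t
      have e1 : ‖a + (t * Complex.I : ℂ) • (1 : B)‖ ^ 2 ≤ ‖a‖ ^ 2 + t ^ 2 := by
        rw [sq, ← CStarRing.norm_star_mul_self]
        have : star (a + (t * Complex.I : ℂ) • (1 : B)) * (a + (t * Complex.I : ℂ) • (1 : B))
            = a * a + ((t ^ 2 : ℝ) : ℂ) • (1 : B) := by
          rw [star_add, star_smul, star_one, hsa.star_eq]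
          simp only [add_mul, mul_add, smul_mul_assoc, mul_smul_comm, one_mul, mul_one]
          have h3 : star (t * Complex.I : ℂ) = - (t * Complex.I) := by simp
          have h4 : (t * Complex.I : ℂ) * (t * Complex.I) = - ((t ^ 2 : ℝ) : ℂ) := by
            push_cast
            linear_combination (t : ℂ) ^ 2 * Complex.I_sq
          rw [h3, smul_add, smul_smul, mul_neg, h4, neg_smul, neg_neg]
          abel
        rw [this]
        refine (norm_add_le _ _).trans ?_
        gcongr
        · rw [sq]; exact norm_mul_le _ _
        · rw [norm_smul, CStarRing.norm_one, Complex.norm_real, Real.norm_of_nonneg (by positivity),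
            mul_one]
      have e2 := hle (a + (t * Complex.I : ℂ) • (1 : B))
      rw [map_add, map_smul, h1] at e2
      have e3 := Complex.abs_im_le_norm (φ a + (t * Complex.I : ℂ) • (1 : ℂ))
      have e4 : (φ a + (t * Complex.I : ℂ) • (1 : ℂ)).im = (φ a).im + t := by simp
      rw [e4] at e3
      calc ((φ a).im + t) ^ 2 = |(φ a).im + t| ^ 2 := (sq_abs _).symm
        _ ≤ _ := pow_le_pow_left₀ (abs_nonneg _) (e3.trans e2) 2
        _ ≤ _ := e1
    by_contra h
    have h5 := hk (‖a‖ ^ 2 / (φ a).im)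
    have h6 : (φ a).im * (‖a‖ ^ 2 / (φ a).im) = ‖a‖ ^ 2 := by field_simp
    have h7 : 0 < (φ a).im ^ 2 := by positivity
    nlinarith [sq_nonneg ‖a‖]
  have hre : 0 ≤ (φ a).re := by
    have h2 : ‖algebraMap ℝ B ‖a‖ - a‖ ≤ ‖a‖ := by
      rw [CStarAlgebra.norm_le_iff_le_algebraMap _ (norm_nonneg _)
        (sub_nonneg.2 (IsSelfAdjoint.le_algebraMap_norm_self hsa))]
      exact sub_le_self _ ha
    have h3 := hle (algebraMap ℝ B ‖a‖ - a)
    have h4 : φ (algebraMap ℝ B ‖a‖) = ((‖a‖ : ℝ) : ℂ) := by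
      rw [Algebra.algebraMap_eq_smul_one, ← Complex.coe_smul, map_smul, h1]; simp
    rw [map_sub, h4] at h3
    have h5 := Complex.re_le_norm (((‖a‖ : ℝ) : ℂ) - φ a)
    rw [Complex.sub_re, Complex.ofReal_re] at h5
    linarith
  rw [Complex.le_def]
  exact ⟨hre, him.symm⟩

theorem aux_ext {B : Type} [CStarAlgebra B] [PartialOrder B] [StarOrderedRing B]
    (a : B) (ha : 0 ≤ a) (ha0 : a ≠ 0) : ∃ φ : B →L[ℂ] ℂ, ‖φ‖ ≤ 1 ∧ φ 1 = 1 ∧ φ a = ‖a‖ ∧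
    (∀ φ₁ φ₂ : B →L[ℂ] ℂ, ‖φ₁‖ ≤ 1 → ‖φ₂‖ ≤ 1 → ∀ t : ℝ, 0 < t → t < 1 →
      (t • φ₁ + (1 - t) • φ₂ = φ) → φ₁ = φ) := by
  have : Nontrivial B := ⟨a, 0, ha0⟩
  have hap : 0 < ‖a‖ := norm_pos_iff.2 ha0
  have hle : ∀ ψ : B →L[ℂ] ℂ, ‖ψ‖ ≤ 1 → ∀ b, ‖ψ b‖ ≤ ‖b‖ :=
    fun ψ hψ b => ψ.le_of_opNorm_le hψ b |>.trans (by simp)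
  set x : B := a + algebraMap ℝ B ‖a‖ with hx
  have hA0 : 0 ≤ algebraMap ℝ B ‖a‖ := by
    rw [Algebra.algebraMap_eq_smul_one]; exact smul_nonneg (norm_nonneg _) zero_le_one
  have hxn : ‖x‖ = 2 * ‖a‖ := by
    apply le_antisymm
    · refine (norm_add_le _ _).trans ?_
      rw [norm_algebraMap']
      simp; linarith
    · have h1 : x ≤ algebraMap ℝ B ‖x‖ :=
        (CStarAlgebra.norm_le_iff_le_algebraMap x (norm_nonneg _) (add_nonneg ha hA0)).1 le_rfl
      have hax : ‖a‖ ≤ ‖x‖ :=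
        CStarAlgebra.norm_le_norm_of_nonneg_of_le ha (le_add_of_nonneg_right hA0)
      have h2 : a ≤ algebraMap ℝ B (‖x‖ - ‖a‖) := by
        rw [map_sub]; exact le_sub_iff_add_le.2 h1
      have := (CStarAlgebra.norm_le_iff_le_algebraMap a (sub_nonneg.2 hax) ha).2 h2
      linarith
  let F : Set (WeakDual ℂ B) :=
    (WeakDual.toStrongDual ⁻¹' Metric.closedBall 0 1) ∩ {ψ | (ψ x).re = 2 * ‖a‖}
  have hmem : ∀ ψ : WeakDual ℂ B, ψ ∈ F ↔ ‖WeakDual.toStrongDual ψ‖ ≤ 1 ∧ (ψ x).re = 2 * ‖a‖ := by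
    intro ψ
    simp [F]
  have hFc : IsCompact F := by
    refine (WeakDual.isCompact_closedBall (0 : StrongDual ℂ B) 1).inter_right ?_
    exact isClosed_eq (Complex.continuous_re.comp (WeakDual.eval_continuous x)) continuous_const
  have hFn : F.Nonempty := by
    have hx0 : x ≠ 0 := by rw [← norm_pos_iff, hxn]; positivity
    obtain ⟨g, hg, hgx⟩ := exists_dual_vector ℂ x (norm_ne_zero_iff.2 hx0)
    refine ⟨StrongDual.toWeakDual g, (hmem _).2 ⟨hg.le, ?_⟩⟩
    change (g x).re = _
    rw [hgx, ← hxn]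
    simp
  have hlc : LocallyConvexSpace ℝ (WeakDual ℂ B) :=
    inferInstanceAs (LocallyConvexSpace ℝ (WeakBilin (topDualPairing ℂ B)))
  obtain ⟨φ, hφ⟩ := hFc.extremePoints_nonempty hFn
  rw [mem_extremePoints] at hφ
  obtain ⟨hφF, hφe⟩ := hφ
  obtain ⟨hφn, hφx⟩ := (hmem _).1 hφF
  let φ' : B →L[ℂ] ℂ := WeakDual.toStrongDual φ
  change (φ' x).re = _ at hφx
  change ‖φ'‖ ≤ 1 at hφn
  have hxe : φ' x = φ' a + ((‖a‖ : ℝ) : ℂ) * φ' 1 := by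
    rw [hx, map_add, Algebra.algebraMap_eq_smul_one, ← Complex.coe_smul, map_smul, smul_eq_mul]
  have hb1 := hle φ' hφn 1
  have hba := hle φ' hφn a
  rw [CStarRing.norm_one] at hb1
  rw [hxe, Complex.add_re, Complex.re_ofReal_mul] at hφx
  have hr1 := Complex.re_le_norm (φ' 1)
  have hra := Complex.re_le_norm (φ' a)
  have q1 : (φ' 1).re = 1 := by nlinarith
  have qa : (φ' a).re = ‖a‖ := by rw [q1] at hφx; linarith
  have real_of : ∀ (z : ℂ) (r : ℝ), z.re = r → ‖z‖ ≤ r → z = r := by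
    intro z r h1 h2
    have h3 : z.re = ‖z‖ := le_antisymm (Complex.re_le_norm z) (by rw [h1]; exact h2)
    have h4 := Complex.re_eq_norm.1 h3
    apply Complex.ext
    · simpa using h1
    · simpa using (Complex.le_def.1 h4).2.symm
  refine ⟨φ', hφn, by simpa using real_of _ 1 q1 hb1, real_of _ _ qa hba, ?_⟩
  intro φ₁ φ₂ h1 h2 t ht0 ht1 hsum
  have hsx : t * (φ₁ x).re + (1 - t) * (φ₂ x).re = 2 * ‖a‖ := by
    have := congrArg (fun f : B →L[ℂ] ℂ => (f x).re) hsum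
    simp only [add_apply, smul_apply, Complex.add_re, Complex.real_smul,
      Complex.re_ofReal_mul] at this
    rw [this, hxe, Complex.add_re, Complex.re_ofReal_mul]
    exact hφx
  have l1 := (Complex.re_le_norm (φ₁ x)).trans (hle φ₁ h1 x)
  have l2 := (Complex.re_le_norm (φ₂ x)).trans (hle φ₂ h2 x)
  rw [hxn] at l1 l2
  have m1 : (φ₁ x).re = 2 * ‖a‖ := by nlinarith
  have m2 : (φ₂ x).re = 2 * ‖a‖ := by nlinarith
  have := hφe (StrongDual.toWeakDual φ₁) ((hmem _).2 ⟨h1, m1⟩)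
    (StrongDual.toWeakDual φ₂) ((hmem _).2 ⟨h2, m2⟩)
    ⟨t, 1 - t, ht0, by linarith, by ring, hsum⟩
  exact this.1

theorem aux_rep {A : Type} [NonUnitalCStarAlgebra A] (c : A) (hc : c ≠ 0) :
    ∃ (H : Type) (_ : NormedAddCommGroup H) (_ : InnerProductSpace ℂ H) (_ : CompleteSpace H)
      (π : A →⋆ₙₐ[ℂ] (H →L[ℂ] H)), π c ≠ 0 ∧ ∀ V : Submodule ℂ H, IsClosed (V : Set H) →
      (∀ a : A, ∀ v ∈ V, π a v ∈ V) → V = ⊥ ∨ V = ⊤ := by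
  let _ : PartialOrder (Unitization ℂ A) := CStarAlgebra.spectralOrder _
  have _ : StarOrderedRing (Unitization ℂ A) := CStarAlgebra.spectralOrderedRing _
  have hc' : (c : Unitization ℂ A) ≠ 0 := by
    intro h
    exact hc (Unitization.inr_injective (R := ℂ) (by simpa using h))
  have ha0 : star (c : Unitization ℂ A) * c ≠ 0 := by
    rwa [Ne, CStarRing.star_mul_self_eq_zero_iff]
  obtain ⟨φ, hn, h1, ha, hext⟩ := aux_ext (star (c : Unitization ℂ A) * c)
    (star_mul_self_nonneg _) ha0
  let f : (Unitization ℂ A) →ₚ[ℂ] ℂ := PositiveLinearMap.mk₀ (φ : Unitization ℂ A →ₗ[ℂ] ℂ)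
    (aux_pos φ hn h1)
  have hf : ∀ b, f b = φ b := fun b => rfl
  let π : Unitization ℂ A →⋆ₙₐ[ℂ] (f.GNS →L[ℂ] f.GNS) := f.gnsNonUnitalStarAlgHom
  have hπ1 : π 1 = 1 := map_one f.gnsStarAlgHom
  let ξ : f.GNS := ((f.toPreGNS 1 : f.PreGNS) : f.GNS)
  have hπξ : ∀ b, π b ξ = ((f.toPreGNS b : f.PreGNS) : f.GNS) := by
    intro b
    change f.gnsNonUnitalStarAlgHom b _ = _
    rw [PositiveLinearMap.gnsNonUnitalStarAlgHom_apply_coe]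
    simp
  have hin : ∀ b b', ⟪π b ξ, π b' ξ⟫_ℂ = φ (star b * b') := by
    intro b b'
    rw [hπξ, hπξ, UniformSpace.Completion.inner_coe, PositiveLinearMap.preGNS_inner_def]
    rfl
  have hξ1 : π 1 ξ = ξ := by rw [hπ1]; rfl
  have hφξ : ∀ b, φ b = ⟪ξ, π b ξ⟫_ℂ := by
    intro b
    have := hin 1 b
    rw [hξ1] at this
    rw [this]; simp
  refine ⟨f.GNS, inferInstance, inferInstance, inferInstance,
    π.comp (Unitization.inrNonUnitalStarAlgHom ℂ A), ?_, ?_⟩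
  · intro h
    have h2 : π (c : Unitization ℂ A) = 0 := h
    have h3 := hin c c
    rw [h2, ha] at h3
    rw [zero_apply, inner_zero_left] at h3
    exact ha0 (norm_eq_zero.1 (by exact_mod_cast h3.symm))
  · intro V hV hinv
    refine aux_irred π ξ φ hφξ ?_ ?_ hext V hV ?_
    · have h2 := hφξ 1
      rw [hξ1, h1, inner_self_eq_norm_sq_to_K] at h2
      have h3 : ‖ξ‖ ^ 2 = 1 := Complex.ofReal_injective (by rw [Complex.ofReal_one, h2, Complex.ofReal_pow]; rfl)
      nlinarith [norm_nonneg ξ]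
    · have : (fun b => π b ξ) = (fun b => ((f.toPreGNS b : f.PreGNS) : f.GNS)) := funext hπξ
      rw [this]
      exact (UniformSpace.Completion.denseRange_coe (α := f.PreGNS)).comp
        f.toPreGNS.surjective.denseRange (UniformSpace.Completion.continuous_coe _)
    · intro b v hv
      induction b using Unitization.ind with
      | inl_add_inr r a =>
        rw [map_add, add_apply]
        refine V.add_mem ?_ (hinv a v hv)
        have : (Unitization.inl r : Unitization ℂ A) = r • 1 := by
          ext <;> simp
        rw [this, map_smul, hπ1]
        exact V.smul_mem _ hv
end helper

theorem prim_prime (ρ : HilbertRep A) (hρ : ρ.IsIrreducible) (x y : A) (hx : ρ.π x ≠ 0)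
    (hy : ρ.π y ≠ 0) : ∃ a, ρ.π (x * a * y) ≠ 0 := by
  by_contra! h
  obtain ⟨h0, hirr⟩ := hρ
  obtain ⟨v, hv⟩ : ∃ v, ρ.π y v ≠ 0 := by
    by_contra! h'
    exact hy (ContinuousLinearMap.ext h')
  let V : Submodule ℂ ρ.carrier := ⨅ a : A, LinearMap.ker (ρ.π (x * a) : ρ.carrier →ₗ[ℂ] ρ.carrier)
  have hVm : ∀ w, w ∈ V ↔ ∀ a, ρ.π (x * a) w = 0 := by
    intro w; simp [V, Submodule.mem_iInf]
  have hVc : IsClosed (V : Set ρ.carrier) := by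
    have : (V : Set ρ.carrier) = ⋂ a, {w | ρ.π (x * a) w = 0} := by
      ext w; rw [SetLike.mem_coe, hVm]; simp
    rw [this]
    exact isClosed_iInter fun a => isClosed_eq (ρ.π (x * a)).continuous continuous_const
  have hV : V = ⊤ := by
    refine (hirr V hVc ?_).resolve_left ?_
    · intro b w hw
      rw [hVm] at hw ⊢
      intro a
      have := hw (a * b)
      rwa [← mul_assoc, map_mul] at this
    · intro hb
      apply hv
      rw [← Submodule.mem_bot ℂ, ← hb, hVm]
      intro a
      have := congrArg (fun T => T v) (h a)
      rwa [map_mul] at this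
  have hxa : ∀ a w, ρ.π x (ρ.π a w) = 0 := by
    intro a w
    have : w ∈ V := by rw [hV]; trivial
    have := (hVm w).1 this a
    rwa [map_mul] at this
  let W : Submodule ℂ ρ.carrier := LinearMap.ker (ρ.π x : ρ.carrier →ₗ[ℂ] ρ.carrier)
  have hWm : ∀ w, w ∈ W ↔ ρ.π x w = 0 := fun w => Iff.rfl
  have hWc : IsClosed (W : Set ρ.carrier) :=
    isClosed_eq (ρ.π x).continuous continuous_const
  rcases hirr W hWc (fun a w _ => (hWm _).2 (hxa a w)) with hW | hW
  · apply h0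
    ext a w
    have : ρ.π a w ∈ W := (hWm _).2 (hxa a w)
    rw [hW, Submodule.mem_bot] at this
    simpa using this
  · apply hx
    ext w
    have : w ∈ W := by rw [hW]; trivial
    simpa using (hWm _).1 this

theorem prim_exists (c : A) (hc : c ≠ 0) : ∃ K : PrimSpace A, c ∉ K.1 := by
  let _ : NonUnitalCStarAlgebra A := {}
  obtain ⟨H, i1, i2, i3, π, h1, h2⟩ := aux_rep c hc
  refine ⟨⟨_, ⟨⟨H, π⟩, ⟨?_, h2⟩, rfl⟩⟩, h1⟩
  intro h
  apply h1
  change π = 0 at h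
  rw [h]; rfl

theorem prim_basis (J : PrimSpace A) (U : Set (PrimSpace A)) (hU : IsOpen U) (hJ : J ∈ U) :
    ∃ x, x ∉ J.1 ∧ ∀ K : PrimSpace A, x ∉ K.1 → K ∈ U := by
  induction hU with
  | basic s hs =>
    obtain ⟨S, rfl⟩ := hs
    obtain ⟨x, hx, hxJ⟩ := Set.not_subset.1 hJ
    exact ⟨x, hxJ, fun K hK => Set.not_subset.2 ⟨x, hx, hK⟩⟩
  | univ =>
    obtain ⟨_, ρ, hρ, rfl⟩ := J
    by_contra! h
    apply hρ.1
    ext1 a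
    by_contra ha
    obtain ⟨K, _, hK⟩ := h a ha
    exact hK trivial
  | inter s t _ _ ihs iht =>
    obtain ⟨x, hx, hxs⟩ := ihs hJ.1
    obtain ⟨y, hy, hyt⟩ := iht hJ.2
    obtain ⟨_, ρ, hρ, rfl⟩ := J
    obtain ⟨a, ha⟩ := prim_prime ρ hρ x y hx hy
    refine ⟨x * a * y, ha, fun K hK => ⟨hxs K fun hk => hK ?_, hyt K fun hk => hK ?_⟩⟩
    · obtain ⟨_, σ, hσ, rfl⟩ := K
      have hk : σ.π x = 0 := hk
      change σ.π _ = 0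
      rw [map_mul, map_mul, hk, zero_mul, zero_mul]
    · obtain ⟨_, σ, hσ, rfl⟩ := K
      have hk : σ.π y = 0 := hk
      change σ.π _ = 0
      rw [map_mul, hk, mul_zero]
  | sUnion S _ ih =>
    obtain ⟨s, hs, hJs⟩ := hJ
    obtain ⟨x, hx, hxs⟩ := ih s hs hJs
    exact ⟨x, hx, fun K hK => ⟨s, hs, hxs K hK⟩⟩

/-- Identifying `Prim(I)` with `{J ∈ Prim(A) : I ⊄ J}`, one has
`Prim(I⊥) = Prim(A) \ closure (Prim(I))`. -/
theorem prim_annihilator_eq_compl_closure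
    (I : TwoSidedIdeal A) (hI : IsClosed (I : Set A)) :
    {J : PrimSpace A | ¬ annihilatorSet I ⊆ J.1} =
      Set.univ \ closure {J : PrimSpace A | ¬ (I : Set A) ⊆ J.1} := by
  ext J
  simp only [Set.mem_ofPred_eq, Set.mem_sdiff, Set.mem_univ, true_and]
  constructor
  · intro hJ hcl
    have hopen : IsOpen {J : PrimSpace A | ¬ annihilatorSet I ⊆ J.1} :=
      TopologicalSpace.isOpen_generateFrom_of_mem ⟨_, rfl⟩
    obtain ⟨K, hK1, hK2⟩ := mem_closure_iff.1 hcl _ hopen hJ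
    obtain ⟨x, hx, hxK⟩ := Set.not_subset.1 hK1
    obtain ⟨y, hy, hyK⟩ := Set.not_subset.1 hK2
    obtain ⟨_, ρ, hρ, rfl⟩ := K
    obtain ⟨a, ha⟩ := prim_prime ρ hρ x y hxK hyK
    apply ha
    rw [mul_assoc, (hx (a * y) (I.mul_mem_left a y hy)).1, map_zero]
  · intro hJ
    obtain ⟨x, hxJ, hx⟩ := prim_basis J _ isClosed_closure.isOpen_compl hJ
    refine Set.not_subset.2 ⟨x, ?_, hxJ⟩
    have hIK : ∀ K : PrimSpace A, x ∉ K.1 → (I : Set A) ⊆ K.1 := by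
      intro K hK
      by_contra h
      exact hx K hK (subset_closure h)
    intro b hb
    constructor
    · by_contra hne
      obtain ⟨K, hK⟩ := prim_exists _ hne
      by_cases hxK : x ∈ K.1
      · obtain ⟨_, σ, hσ, rfl⟩ := K
        have hk : σ.π x = 0 := hxK
        exact hK (show σ.π _ = 0 by rw [map_mul, hk, zero_mul])
      · exact hK (hIK K hxK (I.mul_mem_left _ _ hb))
    · by_contra hne
      obtain ⟨K, hK⟩ := prim_exists _ hne
      by_cases hxK : x ∈ K.1
      · obtain ⟨_, σ, hσ, rfl⟩ := K
        have hk : σ.π x = 0 := hxK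
        exact hK (show σ.π _ = 0 by rw [map_mul, hk, mul_zero])
      · exact hK (hIK K hxK (I.mul_mem_right _ _ hb))
end

section
/- Let X be a compact, connected, locally connected metric space of covering dimension at most 1, and let p, q be projections in C(X, M_n) such that rank(p(x)) = rank(q(x)) for all x ∈ X. Then p and q are Murray–von Neumann equivalent in C(X, M_n), i.e., there exists v ∈ C(X, M_n) with v*v = p and vv* = q. -/
open Matrix

/-- Covering dimension at most `n`: every open cover admits an open refinement
in which each point lies in at most `n + 1` members. -/
def CovDimLE (X : Type*) [TopologicalSpace X] (n : ℕ) : Prop :=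
  ∀ U : Set (Set X), (∀ u ∈ U, IsOpen u) → ⋃₀ U = Set.univ →
    ∃ V : Set (Set X), (∀ v ∈ V, IsOpen v) ∧ ⋃₀ V = Set.univ ∧
      (∀ v ∈ V, ∃ u ∈ U, v ⊆ u) ∧
      ∀ x : X, {v ∈ V | x ∈ v}.Finite ∧ {v ∈ V | x ∈ v}.ncard ≤ n + 1


theorem aux_cstar {A : Type*} [CStarAlgebra A] (p q g : A) (hp : star p = p) (hpp : p * p = p)
    (hq : star q = q) (hg : IsUnit g) (hgp : g * p = q * g) :
    ∃ v : A, star v * v = p ∧ v * star v = q := by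
  let _ : PartialOrder A := CStarAlgebra.spectralOrder A
  have _ : StarOrderedRing A := CStarAlgebra.spectralOrderedRing A
  have hh0 : 0 ≤ star g * g := star_mul_self_nonneg g
  have hhu : IsUnit (star g * g) := hg.star.mul hg
  have hcomm : Commute (star g * g) p := by
    have h2 : p * star g = star g * q := by
      have := congrArg star hgp
      simpa [hp, hq] using this
    show star g * g * p = p * (star g * g)
    rw [mul_assoc, hgp, ← mul_assoc, ← h2, mul_assoc]
  generalize hh : star g * g = h at *
  obtain ⟨a, ha, hac, hah⟩ : ∃ a : A, star a = a ∧ Commute a p ∧ a * h * a = 1 := by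
    refine ⟨h ^ (-(1/2) : ℝ), ?_, ?_, ?_⟩
    · exact (IsSelfAdjoint.of_nonneg CFC.rpow_nonneg).star_eq
    · exact hcomm.cfc_nnreal _
    · nth_rw 2 [← CFC.rpow_one h]
      rw [← CFC.rpow_add hhu, ← CFC.rpow_add hhu]
      norm_num
      exact CFC.rpow_zero h
  have hau : IsUnit a := by
    refine isUnit_iff_exists.2 ⟨h * a, by rw [← mul_assoc, hah], ?_⟩
    obtain ⟨h', rfl⟩ := hhu
    have : (h' : A) * a * a = 1 := by
      have c : Commute (h' : A) a := by
        have l : a * (h' * a) = 1 := by rw [← mul_assoc, hah]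
        have r : (a * h') * a = 1 := hah
        have : (h' : A) * a = a * h' := by
          have := left_inv_eq_right_inv r l
          exact this.symm
        exact this
      rw [c.eq, hah]
    exact this
  have huu : star (g * a) * (g * a) = 1 := by
    rw [star_mul, ha, ← hah, ← hh]; simp only [mul_assoc]
  have hu2 : (g * a) * star (g * a) = 1 := by
    obtain ⟨u, hu⟩ := hg.mul hau
    rw [← hu] at huu ⊢
    rw [Units.mul_eq_one_iff_eq_inv.1 huu]; simp
  have hup : (g * a) * p = q * (g * a) := by
    rw [mul_assoc, hac.eq, ← mul_assoc, hgp, mul_assoc]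
  generalize g * a = u at *
  refine ⟨u * p, ?_, ?_⟩
  · rw [star_mul, hp, mul_assoc, ← mul_assoc (star u), huu, one_mul, hpp]
  · rw [star_mul, hp, mul_assoc, ← mul_assoc p, hpp, ← mul_assoc, hup, mul_assoc, hu2, mul_one]

section
open scoped Matrix.Norms.L2Operator
theorem aux_fun {X : Type*} [TopologicalSpace X] [CompactSpace X] {n : ℕ}
    (p q g : C(X, Matrix (Fin n) (Fin n) ℂ))
    (hp : ∀ x : X, (p x)ᴴ = p x ∧ p x * p x = p x)
    (hq : ∀ x : X, (q x)ᴴ = q x ∧ q x * q x = q x)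
    (hg : ∀ x, (g x).det ≠ 0) (hgp : ∀ x, g x * p x = q x * g x) :
    ∃ v : C(X, Matrix (Fin n) (Fin n) ℂ),
      ∀ x : X, (v x)ᴴ * v x = p x ∧ v x * (v x)ᴴ = q x := by
  have hgc : Continuous fun x => (g x)⁻¹ := by
    simp only [Matrix.inv_def, Ring.inverse_eq_inv']
    exact (Continuous.inv₀ (g.continuous.matrix_det) hg).smul g.continuous.matrix_adjugate
  have hu : IsUnit g := by
    refine isUnit_iff_exists.2 ⟨⟨_, hgc⟩, ?_, ?_⟩
    · ext1 x; exact Matrix.mul_nonsing_inv _ (isUnit_iff_ne_zero.2 (hg x))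
    · ext1 x; exact Matrix.nonsing_inv_mul _ (isUnit_iff_ne_zero.2 (hg x))
  obtain ⟨v, h1, h2⟩ := aux_cstar (A := C(X, Matrix (Fin n) (Fin n) ℂ)) p q g
    (by ext1 x; exact (hp x).1) (by ext1 x; exact (hp x).2) (by ext1 x; exact (hq x).1) hu
    (by ext1 x; exact hgp x)
  exact ⟨v, fun x => ⟨DFunLike.congr_fun h1 x, DFunLike.congr_fun h2 x⟩⟩
end

theorem aux_path {n : ℕ} (P Q A B : Matrix (Fin n) (Fin n) ℂ)
    (hA : (Q * A * P + (1 - Q) * A * (1 - P)).det ≠ 0)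
    (hB : (Q * B * P + (1 - Q) * B * (1 - P)).det ≠ 0) :
    ∃ γ : Path A B, ∀ t, (Q * γ t * P + (1 - Q) * γ t * (1 - P)).det ≠ 0 := by
  let L : Matrix (Fin n) (Fin n) ℂ → Matrix (Fin n) (Fin n) ℂ :=
    fun A => Q * A * P + (1 - Q) * A * (1 - P)
  let R : Polynomial ℂ :=
    ((L A).map Polynomial.C + (Polynomial.X : Polynomial ℂ) • (L (B - A)).map Polynomial.C).det
  have hR : ∀ z : ℂ, R.eval z = (L (A + z • (B - A))).det := by
    intro z
    simp only [R]
    rw [← Polynomial.coe_evalRingHom, RingHom.map_det]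
    congr 1
    have : L (A + z • (B - A)) = L A + z • L (B - A) := by
      simp only [L, mul_add, add_mul, smul_add, mul_smul_comm, smul_mul_assoc]
      abel
    rw [this]
    ext i j
    simp
    exact mul_comm _ _
  have hR0 : R ≠ 0 := by
    intro h
    have := hR 0
    rw [h] at this
    simp at this
    exact hA this.symm
  have hpc : IsPathConnected ({z : ℂ | R.IsRoot z}ᶜ) :=
    Set.Countable.isPathConnected_compl_of_one_lt_rank (by simp)
      (Polynomial.finite_setOfPred_isRoot hR0).countable
  obtain ⟨γ, hγ⟩ := hpc.joinedIn 0 (by simp [Polynomial.IsRoot, hR]; exact hA) 1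
    (by simp [Polynomial.IsRoot, hR]; exact hB)
  refine ⟨(γ.map (f := fun z : ℂ => A + z • (B - A)) (by fun_prop)).cast (by simp) (by simp), ?_⟩
  intro t
  have := hγ t
  simp only [Set.mem_compl_iff, Set.mem_ofPred_eq, Polynomial.IsRoot, hR] at this
  exact this

theorem aux_exists {n : ℕ} (P Q : Matrix (Fin n) (Fin n) ℂ) (hP : P * P = P) (hQ : Q * Q = Q)
    (hr : P.rank = Q.rank) : ∃ A : Matrix (Fin n) (Fin n) ℂ,
    (Q * A * P + (1 - Q) * A * (1 - P)).det ≠ 0 := by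
  have key : ∀ P : Matrix (Fin n) (Fin n) ℂ, P * P = P →
      IsCompl P.toLin'.range P.toLin'.ker ∧ ∀ x ∈ P.toLin'.range, P.toLin' x = x := by
    intro P hP
    have hi : IsIdempotentElem P.toLin' := by
      show P.toLin' ∘ₗ P.toLin' = _
      rw [← Matrix.toLin'_mul, hP]
    exact ⟨LinearMap.IsIdempotentElem.isCompl hi,
      fun x hx => (LinearMap.IsIdempotentElem.mem_range_iff hi).1 hx⟩
  obtain ⟨cP, fP⟩ := key P hP
  obtain ⟨cQ, fQ⟩ := key Q hQ
  have r1 : Module.finrank ℂ P.toLin'.range = Module.finrank ℂ Q.toLin'.range := hr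
  have r2 : Module.finrank ℂ P.toLin'.ker = Module.finrank ℂ Q.toLin'.ker := by
    have := P.toLin'.finrank_range_add_finrank_ker
    have := Q.toLin'.finrank_range_add_finrank_ker
    omega
  let e := (Submodule.prodEquivOfIsCompl _ _ cP).symm ≪≫ₗ
    ((LinearEquiv.ofFinrankEq _ _ r1).prodCongr (LinearEquiv.ofFinrankEq _ _ r2)) ≪≫ₗ
    (Submodule.prodEquivOfIsCompl _ _ cQ)
  let A := LinearMap.toMatrix' e.toLinearMap
  have hA : A.det ≠ 0 := by
    simpa [A] using e.isUnit_det'.ne_zero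
  have hAP : A * P = Q * A := by
    apply Matrix.toLin'.injective
    rw [Matrix.toLin'_mul, Matrix.toLin'_mul, Matrix.toLin'_toMatrix']
    have e1 : ∀ y : P.toLin'.range, Q.toLin' (e y) = e y := by
      intro y
      apply fQ
      simp [e, -LinearMap.mem_range]
    have e2 : ∀ y : P.toLin'.ker, Q.toLin' (e y) = 0 := by
      intro y
      rw [← LinearMap.mem_ker]
      simp [e, -LinearMap.mem_ker]
    refine LinearMap.ext fun x => ?_
    obtain ⟨⟨y, k⟩, rfl⟩ := (Submodule.prodEquivOfIsCompl _ _ cP).surjective x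
    have e3 := fP y y.2
    have e4 : P.toLin' k = 0 := k.2
    have e5 := e1 y
    have e6 := e2 k
    simp only [LinearMap.comp_apply, Submodule.coe_prodEquivOfIsCompl', map_add, e3, e4,
      LinearEquiv.coe_coe, e5, e6, map_zero]
  refine ⟨A, ?_⟩
  have : Q * A * P + (1 - Q) * A * (1 - P) = A := by
    rw [← hAP, mul_assoc, hP, sub_mul, one_mul, ← hAP]
    simp only [mul_sub, sub_mul, mul_one, mul_assoc, hP]
    abel
  rwa [this]

open scoped unitInterval in
theorem aux_nerve {X E : Type*} [TopologicalSpace X] [NormalSpace X] [AddCommGroup E]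
    [Module ℝ E] [TopologicalSpace E] [IsTopologicalAddGroup E] [ContinuousSMul ℝ E]
    {N : ℕ} (V : Fin N → Set X) (hVo : ∀ a, IsOpen (V a)) (hVc : ∀ x, ∃ a, x ∈ V a)
    (hV : ∀ x a b c, x ∈ V a → x ∈ V b → x ∈ V c → a = b ∨ b = c ∨ a = c)
    (Good : X → E → Prop) (A : Fin N → E) (hA : ∀ a, ∀ x ∈ V a, Good x (A a))
    (γ : ∀ a b, Path (A a) (A b)) (hγ : ∀ a b x, x ∈ V a → x ∈ V b → ∀ t, Good x (γ a b t)) :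
    ∃ f : C(X, E), ∀ x, Good x (f x) := by
  classical
  obtain ⟨φ, hφ⟩ := PartitionOfUnity.exists_isSubordinate_of_locallyFinite isClosed_univ V hVo
    (locallyFinite_of_finite V) (fun x _ => by simpa using hVc x)
  have hφ0 : ∀ a x, x ∉ V a → φ a x = 0 := by
    intro a x hx
    by_contra h
    exact hx (hφ a (subset_tsupport _ h))
  have hφ1 : ∀ x, ∑ a, φ a x = 1 := by
    intro x
    have := φ.sum_eq_one (Set.mem_univ x)
    rwa [finsum_eq_sum_of_fintype] at this
  have hsum2 : ∀ x a b, a ≠ b → x ∈ V a → x ∈ V b → φ a x + φ b x = 1 := by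
    intro x a b hab ha hb
    rw [← hφ1 x, ← Finset.sum_pair (f := fun c => φ c x) hab]
    refine Finset.sum_subset (Finset.subset_univ _) fun c _ hc => hφ0 _ _ fun hxc => ?_
    have := hV x a b c ha hb hxc
    simp at hc
    grind
  let η : Fin N → Fin N → ℝ → E := fun a b t => (γ a b).extend t - (1 - t) • A a - t • A b
  have hη : ∀ a b, Continuous (η a b) := by
    intro a b
    have := (γ a b).continuous_extend
    simp only [η]
    fun_prop
  have hη0 : ∀ a b, η a b 0 = 0 := by intro a b; simp [η]
  have hη1 : ∀ a b, η a b 1 = 0 := by intro a b; simp [η]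
  let ψ : Fin N × Fin N → X → E := fun c x =>
    if x ∈ V c.1 ∩ V c.2 then η c.1 c.2 (φ c.2 x) else 0
  have hψ : ∀ c : Fin N × Fin N, c.1 < c.2 → Continuous (ψ c) := by
    rintro ⟨a, b⟩ hab
    refine Continuous.if ?_ ((hη a b).comp (φ b).continuous) continuous_const
    intro x hx
    have ho : IsOpen (V a ∩ V b) := (hVo a).inter (hVo b)
    have hx' : x ∈ closure (V a ∩ V b) \ (V a ∩ V b) := by
      rw [← ho.frontier_eq]; exact hx
    have hs : φ a x + φ b x = 1 := by
      have hcl : IsClosed {x | φ a x + φ b x = 1} :=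
        isClosed_eq ((φ a).continuous.add (φ b).continuous) continuous_const
      exact closure_minimal (fun y hy => hsum2 y a b hab.ne hy.1 hy.2) hcl hx'.1
    show η a b (φ b x) = 0
    by_cases h : x ∈ V b
    · have : x ∉ V a := fun h' => hx'.2 ⟨h', h⟩
      rw [hφ0 a x this, zero_add] at hs
      rw [hs, hη1]
    · rw [hφ0 b x h, hη0]
  let S : Finset (Fin N × Fin N) := Finset.univ.filter fun c => c.1 < c.2
  refine ⟨⟨fun x => ∑ a, φ a x • A a + ∑ c ∈ S, ψ c x, ?_⟩, ?_⟩
  · refine Continuous.add ?_ ?_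
    · exact continuous_finsetSum _ fun a _ => (φ a).continuous.smul continuous_const
    · exact continuous_finsetSum _ fun c hc => hψ c (by simpa [S] using hc)
  intro x
  show Good x (∑ a, φ a x • A a + ∑ c ∈ S, ψ c x)
  obtain ⟨a, ha⟩ := hVc x
  by_cases h : ∃ b, b ≠ a ∧ x ∈ V b
  · obtain ⟨a, b, hab, ha, hb⟩ : ∃ a b, a < b ∧ x ∈ V a ∧ x ∈ V b := by
      obtain ⟨b, hne, hb⟩ := h
      rcases lt_or_gt_of_ne hne with h | h
      · exact ⟨b, a, h, hb, ha⟩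
      · exact ⟨a, b, h, ha, hb⟩
    have hmem : ∀ c, x ∈ V c → c = a ∨ c = b := by
      intro c hc
      have := hV x a b c ha hb hc
      grind
    have e1 : ∑ c, φ c x • A c = φ a x • A a + φ b x • A b := by
      rw [← Finset.sum_pair (f := fun c => φ c x • A c) hab.ne]
      symm
      refine Finset.sum_subset (Finset.subset_univ _) fun c _ hc => ?_
      rw [hφ0 c x, zero_smul]
      intro hxc
      have := hmem c hxc
      simp at hc
      grind
    have e2 : ∑ c ∈ S, ψ c x = η a b (φ b x) := by
      rw [Finset.sum_eq_single (a, b)]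
      · simp [ψ, ha, hb]
      · rintro ⟨c, d⟩ hcd hne
        simp only [S, Finset.mem_filter, Finset.mem_univ, true_and] at hcd
        refine if_neg ?_
        rintro ⟨h1, h2⟩
        have := hmem c h1
        have := hmem d h2
        grind
      · intro h
        exact absurd (by simpa [S] using hab) h
    have hs := hsum2 x a b hab.ne ha hb
    have e3 : φ a x = 1 - φ b x := by linarith
    have hI : φ b x ∈ I := ⟨φ.nonneg b x, φ.le_one b x⟩
    have e4 : φ a x • A a + φ b x • A b + η a b (φ b x) = γ a b ⟨φ b x, hI⟩ := by
      rw [← Path.extend_apply _ hI, e3]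
      simp only [η]
      abel
    rw [e1, e2, e4]
    exact hγ a b x ha hb _
  · have hmem : ∀ c, x ∈ V c → c = a := by
      intro c hc
      by_contra hne
      exact h ⟨c, hne, hc⟩
    have hz : ∀ c, c ≠ a → φ c x = 0 := fun c hc => hφ0 c x fun h' => hc (hmem c h')
    have e0 : φ a x = 1 := by
      rw [← hφ1 x, Finset.sum_eq_single a] 
      · intro c _ hc; exact hz c hc
      · simp
    have e1 : ∑ c, φ c x • A c = A a := by
      rw [Finset.sum_eq_single a, e0, one_smul]
      · intro c _ hc; rw [hz c hc, zero_smul]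
      · simp
    have e2 : ∑ c ∈ S, ψ c x = 0 := by
      refine Finset.sum_eq_zero ?_
      rintro ⟨c, d⟩ hcd
      simp only [S, Finset.mem_filter, Finset.mem_univ, true_and] at hcd
      refine if_neg ?_
      rintro ⟨h1, h2⟩
      have := hmem c h1
      have := hmem d h2
      grind
    rw [e1, e2, add_zero]
    exact hA a x ha

open Topology in
theorem aux_good {X E : Type*} [MetricSpace X] [CompactSpace X] (hdim : CovDimLE X 1)
    [AddCommGroup E] [Module ℝ E] [TopologicalSpace E] [IsTopologicalAddGroup E]
    [ContinuousSMul ℝ E] (Good : X → E → Prop) (hGo : IsOpen {z : X × E | Good z.1 z.2})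
    (hex : ∀ x, ∃ A, Good x A)
    (hpath : ∀ x A B, Good x A → Good x B → ∃ γ : Path A B, ∀ t, Good x (γ t)) :
    ∃ f : C(X, E), ∀ x, Good x (f x) := by
  classical
  -- finite family of matrices
  choose A₀ hA₀ using hex
  have hUo : ∀ A : E, IsOpen {x | Good x A} := fun A =>
    hGo.preimage (continuous_id.prodMk continuous_const)
  obtain ⟨F, hF⟩ := isCompact_univ.elim_finite_subcover (fun x : X => {y | Good y (A₀ x)})
    (fun x => hUo _) (fun x _ => Set.mem_iUnion.2 ⟨x, hA₀ x⟩)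
  obtain ⟨δ, hδ, hLeb⟩ := lebesgue_number_lemma_of_metric isCompact_univ
    (c := fun i : F => {y | Good y (A₀ i)}) (fun i => hUo _) (fun x hx => by
      have := hF hx
      simpa using this)
  have hLeb' : ∀ x : X, ∃ i : F, ∀ y, dist y x < δ → Good y (A₀ i) := by
    intro x
    obtain ⟨i, hi⟩ := hLeb x (Set.mem_univ x)
    exact ⟨i, fun y hy => hi (Metric.mem_ball.2 hy)⟩
  choose ι hι using hLeb'
  -- paths
  have hpth : ∀ (x : X) (i j : F), ∃ γ : Path (A₀ i) (A₀ j),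
      Good x (A₀ i) → Good x (A₀ j) → ∀ t, Good x (γ t) := by
    intro x i j
    by_cases h : Good x (A₀ i) ∧ Good x (A₀ j)
    · obtain ⟨γ, hγ⟩ := hpath x _ _ h.1 h.2
      exact ⟨γ, fun _ _ => hγ⟩
    · exact ⟨(PathConnectedSpace.joined _ _).somePath, fun h1 h2 => absurd ⟨h1, h2⟩ h⟩
  choose γ hγ using hpth
  have hN : ∀ x : X, ∃ W : Set X, IsOpen W ∧ x ∈ W ∧ (∀ y ∈ W, dist y x < δ / 2) ∧
      ∀ i j : F, Good x (A₀ i) → Good x (A₀ j) → ∀ y ∈ W, ∀ t, Good y (γ x i j t) := by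
    intro x
    have h1 : ∀ᶠ y in 𝓝 x, dist y x < δ / 2 := Metric.ball_mem_nhds x (half_pos hδ)
    have h2 : ∀ᶠ y in 𝓝 x, ∀ i j : F, Good x (A₀ i) → Good x (A₀ j) →
        ∀ t, Good y (γ x i j t) := by
      refine Filter.eventually_all.2 fun i => Filter.eventually_all.2 fun j => ?_
      by_cases h : Good x (A₀ i) ∧ Good x (A₀ j)
      · have := isCompact_univ.eventually_forall_of_forall_eventually (x₀ := x)
          (P := fun y t => Good y (γ x i j t)) (fun t _ => by
            have ho : IsOpen {z : X × unitInterval | Good z.1 (γ x i j z.2)} :=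
              hGo.preimage (continuous_fst.prodMk ((γ x i j).continuous.comp continuous_snd))
            exact ho.mem_nhds (hγ x i j h.1 h.2 t))
        filter_upwards [this] with y hy _ _ t using hy t (Set.mem_univ t)
      · exact Filter.Eventually.of_forall fun y h1 h2 => absurd ⟨h1, h2⟩ h
    obtain ⟨W, hW, hWo, hxW⟩ := mem_nhds_iff.1 (h1.and h2)
    exact ⟨W, hWo, hxW, fun y hy => (hW hy).1, fun i j hi hj y hy => (hW hy).2 i j hi hj⟩
  choose W hWo hxW hWd hWγ using hN
  obtain ⟨V, hVo, hVc, hVr, hVord⟩ := hdim (Set.range W) (by rintro _ ⟨x, rfl⟩; exact hWo x)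
    (Set.eq_univ_of_forall fun x => ⟨W x, ⟨x, rfl⟩, hxW x⟩)
  obtain ⟨T, hT⟩ := isCompact_univ.elim_finite_subcover (fun v : V => (v : Set X))
    (fun v => hVo v v.2) (fun x _ => by
      rw [← Set.sUnion_eq_iUnion, hVc]; trivial)
  let e := T.equivFin.symm
  let V' : Fin T.card → Set X := fun a => ((e a : V) : Set X)
  have hr : ∀ a, ∃ x, V' a ⊆ W x := by
    intro a
    obtain ⟨_, ⟨x, rfl⟩, h⟩ := hVr _ (e a : V).2
    exact ⟨x, h⟩
  choose c hc using hr
  have hgood : ∀ a b x, x ∈ V' a → x ∈ V' b → Good (c a) (A₀ (ι (c b))) := by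
    intro a b x ha hb
    apply hι
    have h1 := hWd _ _ (hc a ha)
    have h2 := hWd _ _ (hc b hb)
    have := dist_triangle_left (c a) (c b) x
    linarith
  refine aux_nerve V' (fun a => hVo _ (e a : V).2) ?_ ?_ Good (fun a => A₀ (ι (c a))) ?_
    (fun a b => γ (c a) (ι (c a)) (ι (c b))) ?_
  · intro x
    obtain ⟨v, hv, hx⟩ := Set.mem_iUnion₂.1 (hT (Set.mem_univ x))
    refine ⟨T.equivFin ⟨v, hv⟩, ?_⟩
    simpa [V', e] using hx
  · intro x a b d ha hb hd
    by_contra! hne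
    have hinj : Function.Injective V' := fun a b h =>
      e.injective (Subtype.ext (Subtype.ext h))
    obtain ⟨hfin, hcard⟩ := hVord x
    have hsub : (({V' a, V' b, V' d} : Finset (Set X)) : Set (Set X)) ⊆ {v ∈ V | x ∈ v} := by
      intro v hv
      simp only [Finset.coe_insert, Finset.coe_singleton, Set.mem_insert_iff,
        Set.mem_singleton_iff] at hv
      rcases hv with rfl | rfl | rfl
      · exact ⟨(e a : V).2, ha⟩
      · exact ⟨(e b : V).2, hb⟩
      · exact ⟨(e d : V).2, hd⟩
    have h3 := Set.ncard_le_ncard hsub hfin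
    rw [Set.ncard_coe_finset, Finset.card_eq_three.2
      ⟨_, _, _, hinj.ne hne.1, hinj.ne hne.2.2, hinj.ne hne.2.1, rfl⟩] at h3
    omega
  · intro a x hx
    apply hι
    have := hWd _ _ (hc a hx)
    linarith
  · intro a b x ha hb t
    exact hWγ (c a) _ _ (hgood a a x ha ha) (hgood a b x ha hb) x (hc a ha) t

/-- Over a compact, connected, locally connected metric space of covering
dimension at most one, projections in `C(X, M_n)` with the same pointwise rank
are Murray–von Neumann equivalent. -/
theorem projections_equiv_of_rank_eq
    (X : Type*) [MetricSpace X] [CompactSpace X] [ConnectedSpace X]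
    [LocallyConnectedSpace X] (hdim : CovDimLE X 1) (n : ℕ)
    (p q : C(X, Matrix (Fin n) (Fin n) ℂ))
    (hp : ∀ x : X, (p x)ᴴ = p x ∧ p x * p x = p x)
    (hq : ∀ x : X, (q x)ᴴ = q x ∧ q x * q x = q x)
    (hrank : ∀ x : X, (p x).rank = (q x).rank) :
    ∃ v : C(X, Matrix (Fin n) (Fin n) ℂ),
      ∀ x : X, (v x)ᴴ * v x = p x ∧ v x * (v x)ᴴ = q x := by
  let L : X → Matrix (Fin n) (Fin n) ℂ → Matrix (Fin n) (Fin n) ℂ := fun x A => q x * A * p x + (1 - q x) * A * (1 - p x)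
  let Good : X → Matrix (Fin n) (Fin n) ℂ → Prop := fun x A => (L x A).det ≠ 0
  have hLc : Continuous fun z : X × Matrix (Fin n) (Fin n) ℂ => L z.1 z.2 := by
    have h1 := p.continuous
    have h2 := q.continuous
    simp only [L]
    fun_prop
  have hGo : IsOpen {z : X × Matrix (Fin n) (Fin n) ℂ | Good z.1 z.2} :=
    isOpen_ne.preimage hLc.matrix_det
  suffices h : ∃ f : C(X, Matrix (Fin n) (Fin n) ℂ), ∀ x, Good x (f x) by
    obtain ⟨f, hf⟩ := h
    have hc : Continuous fun x => L x (f x) := by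
      have h1 := p.continuous
      have h2 := q.continuous
      have h3 := f.continuous
      simp only [L]
      fun_prop
    refine aux_fun p q (ContinuousMap.mk (fun x => L x (f x)) hc) hp hq (fun x => hf x) ?_
    intro x
    have h1 := (hp x).2
    have h2 := (hq x).2
    show L x (f x) * p x = q x * L x (f x)
    simp only [L, add_mul, mul_add, mul_assoc, sub_mul, one_mul, mul_sub, mul_one, h1, sub_self,
      mul_zero, add_zero]
    simp only [← mul_assoc, h2, sub_self, add_zero, mul_zero]
  exact aux_good hdim Good hGo (fun x => aux_exists _ _ (hp x).2 (hq x).2 (hrank x))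
    (fun x A B hA hB => aux_path (p x) (q x) A B hA hB)
end
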